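/- arXiv:2109.12672 — 3 statements merged into one kernel-verified Lean document; each statement's English description precedes it below -/
import Mathlib

section
/- Let k be an algebraically closed field of characteristic zero and let S ⊆ ℙ³ be a smooth cubic surface, the zero locus of a homogeneous cubic form F with no nonzero common zero of its partial derivatives. Then S contains exactly 36 double sixes: the set of unordered pairs of sixes {(ℓ₁,…,ℓ₆),(ℓ′₁,…,ℓ′₆)} on S (taken up to simultaneous reordering of the two tuples by the same permutation) such that ℓᵢ is disjoint from ℓ′ᵢ for all i and ℓᵢ meets ℓ′ⱼ whenever i ≠ j, has cardinality 36. Equivalently, the set of 12-element sets of lines on S that can be enumerated so as to form a double six has exactly 36 elements. -/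
open MvPolynomial

/-- A *line* on the cubic surface defined by `F`: a 2-dimensional linear subspace of `k⁴`
on which `F` vanishes identically. -/
def IsLineOn {k : Type} [Field k] (F : MvPolynomial (Fin 4) k)
    (W : Submodule k (Fin 4 → k)) : Prop :=
  Module.finrank k W = 2 ∧ ∀ v ∈ W, eval v F = 0

/-- A *six* on the cubic surface defined by `F`: an ordered 6-tuple of pairwise disjoint
lines. -/
def IsSix {k : Type} [Field k] (F : MvPolynomial (Fin 4) k)
    (ℓ : Fin 6 → Submodule k (Fin 4 → k)) : Prop :=
  (∀ i, IsLineOn F (ℓ i)) ∧ ∀ i j, i ≠ j → ℓ i ⊓ ℓ j = ⊥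

/-- A pair of sixes `ℓ`, `ℓ'` forms a *double six*: `ℓ i` and `ℓ' i` are disjoint for
every `i`, while `ℓ i` and `ℓ' j` meet whenever `i ≠ j`. -/
def IsDoubleSix {k : Type} [Field k] (F : MvPolynomial (Fin 4) k)
    (ℓ ℓ' : Fin 6 → Submodule k (Fin 4 → k)) : Prop :=
  IsSix F ℓ ∧ IsSix F ℓ' ∧
    (∀ i, ℓ i ⊓ ℓ' i = ⊥) ∧ (∀ i j, i ≠ j → ℓ i ⊓ ℓ' j ≠ ⊥)

section Setup
variable {k : Type} [Field k] {V : Type} [AddCommGroup V] [Module k V]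

/-- Symmetric trilinear form of a smooth cubic surface in a four-dimensional space. -/
structure SC (T : V →ₗ[k] V →ₗ[k] V →ₗ[k] k) : Prop where
  s1 : ∀ u v w, T u v w = T v u w
  s2 : ∀ u v w, T u v w = T u w v
  sm : ∀ v, (∀ u, T v v u = 0) → v = 0
  dim : Module.finrank k V = 4

/-- Lines on the surface, in terms of the trilinear form. -/
def LN (T : V →ₗ[k] V →ₗ[k] V →ₗ[k] k) (W : Submodule k V) : Prop :=
  Module.finrank k W = 2 ∧ ∀ v ∈ W, T v v v = 0

lemma binary_quadratic_zero [IsAlgClosed k] (A B C : k) :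
    ∃ x y : k, (x ≠ 0 ∨ y ≠ 0) ∧ A * x ^ 2 + B * x * y + C * y ^ 2 = 0 := by
  by_cases hA : A = 0
  · exact ⟨1, 0, Or.inl one_ne_zero, by simp [hA]⟩
  · have hd : (Polynomial.C A * Polynomial.X ^ 2 + Polynomial.C B * Polynomial.X
        + Polynomial.C C).degree ≠ 0 := by
      rw [Polynomial.degree_quadratic hA]; decide
    obtain ⟨x, hx⟩ := IsAlgClosed.exists_root _ hd
    refine ⟨x, 1, Or.inr one_ne_zero, ?_⟩
    simp [Polynomial.IsRoot] at hx
    linear_combination hx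

lemma binary_cubic_zero [IsAlgClosed k] (A B C D : k) :
    ∃ x y : k, (x ≠ 0 ∨ y ≠ 0) ∧ A * x ^ 3 + B * x ^ 2 * y + C * x * y ^ 2 + D * y ^ 3 = 0 := by
  by_cases hA : A = 0
  · exact ⟨1, 0, Or.inl one_ne_zero, by simp [hA]⟩
  · have hd : (Polynomial.C A * Polynomial.X ^ 3 + Polynomial.C B * Polynomial.X ^ 2
        + Polynomial.C C * Polynomial.X + Polynomial.C D).degree ≠ 0 := by
      rw [Polynomial.degree_cubic hA]; decide
    obtain ⟨x, hx⟩ := IsAlgClosed.exists_root _ hd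
    refine ⟨x, 1, Or.inr one_ne_zero, ?_⟩
    simp [Polynomial.IsRoot] at hx
    linear_combination hx

/-- Vanishing of the resultant of a binary quadratic and a binary cubic gives a common zero. -/
lemma resultant_zero [IsAlgClosed k] (b0 b1 b2 c0 c1 c2 c3 : k)
    (h : b0 ^ 3 * c3 ^ 2 - b0 ^ 2 * b1 * c2 * c3 + b0 ^ 2 * b2 * (c2 ^ 2 - 2 * c1 * c3)
      + b0 * b1 ^ 2 * c1 * c3 + b0 * b1 * b2 * (3 * c0 * c3 - c1 * c2)
      + b0 * b2 ^ 2 * (c1 ^ 2 - 2 * c0 * c2) - b1 ^ 3 * c0 * c3 + b1 ^ 2 * b2 * c0 * c2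
      - b1 * b2 ^ 2 * c0 * c1 + b2 ^ 3 * c0 ^ 2 = 0) :
    ∃ y z : k, (y ≠ 0 ∨ z ≠ 0) ∧ b0 * y ^ 2 + b1 * y * z + b2 * z ^ 2 = 0 ∧
      c0 * y ^ 3 + c1 * y ^ 2 * z + c2 * y * z ^ 2 + c3 * z ^ 3 = 0 := by
  -- factor the quadratic
  obtain ⟨p, q, p', q', h0, h1, h2⟩ : ∃ p q p' q' : k, b0 = q * q' ∧
      b1 = - (p * q' + p' * q) ∧ b2 = p * p' := by
    obtain ⟨x, y, hxy, hq⟩ := binary_quadratic_zero b0 b1 b2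
    by_cases hy : y = 0
    · subst hy
      have hx : x ≠ 0 := by simpa using hxy
      have hb : b0 = 0 := by simpa [hx] using hq
      exact ⟨1, 0, b2, -b1, by simp [hb], by simp, by simp⟩
    · refine ⟨x, y, -(b1 + b0 * x / y) / y, b0 / y, ?_, ?_, ?_⟩
      · field_simp
      · field_simp; ring
      · field_simp; linear_combination hq
  have key : (c0 * p ^ 3 + c1 * p ^ 2 * q + c2 * p * q ^ 2 + c3 * q ^ 3) *
      (c0 * p' ^ 3 + c1 * p' ^ 2 * q' + c2 * p' * q' ^ 2 + c3 * q' ^ 3) = 0 := by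
    rw [← h, h0, h1, h2]; ring
  by_cases hz : b0 = 0 ∧ b1 = 0 ∧ b2 = 0
  · obtain ⟨x, y, hxy, hc⟩ := binary_cubic_zero c0 c1 c2 c3
    exact ⟨x, y, hxy, by simp [hz.1, hz.2.1, hz.2.2], hc⟩
  rcases mul_eq_zero.mp key with hk | hk
  · refine ⟨p, q, ?_, ?_, hk⟩
    · by_contra hc
      push Not at hc
      exact hz ⟨by simp [h0, hc], by simp [h1, hc], by simp [h2, hc]⟩
    · rw [h0, h1, h2]; ring
  · refine ⟨p', q', ?_, ?_, hk⟩
    · by_contra hc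
      push Not at hc
      exact hz ⟨by simp [h0, hc], by simp [h1, hc], by simp [h2, hc]⟩
    · rw [h0, h1, h2]; ring

variable {T : V →ₗ[k] V →ₗ[k] V →ₗ[k] k}

lemma SC.polar [CharZero k] (h : SC T) {W : Submodule k V} (hW : LN T W) :
    ∀ u ∈ W, ∀ v ∈ W, ∀ w ∈ W, T u v w = 0 := by
  have h1 : ∀ u ∈ W, ∀ v ∈ W, T u u v = 0 := by
    intro u hu v hv
    have a := hW.2 _ (W.add_mem hu hv)
    have b := hW.2 _ (W.sub_mem hu hv)
    have c := hW.2 _ hu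
    have d := hW.2 _ hv
    simp only [map_add, map_sub, LinearMap.add_apply, LinearMap.sub_apply, c, d] at a b
    have e1 := h.s2 u v u
    have e2 := h.s1 v u u
    have e3 : (6 : k) * T u u v = 0 := by
      linear_combination a - b - 2 * e1 - 2 * (e2 + e1)
    simpa using e3
  intro u hu v hv w hw
  have a := h1 _ (W.add_mem hu hv) w hw
  simp only [map_add, LinearMap.add_apply, h1 u hu w hw, h1 v hv w hw] at a
  have e := h.s1 u v w
  have e3 : (2 : k) * T u v w = 0 := by linear_combination a + e
  simpa using e3

lemma finrank_pair {a b : V} (hi : LinearIndependent k ![a, b]) :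
    Module.finrank k (Submodule.span k ({a, b} : Set V)) = 2 := by
  have e : Set.range ![a, b] = {a, b} := by
    ext x; simp [eq_comm, or_comm]
  rw [← e, finrank_span_eq_card hi, Fintype.card_fin]

/-- The set of vectors on the span of two vectors. -/
lemma LN_of_pair [CharZero k] (h : SC T) {a b : V} (hi : LinearIndependent k ![a, b])
    (h1 : T a a a = 0) (h2 : T a a b = 0) (h3 : T a b b = 0) (h4 : T b b b = 0) :
    LN T (Submodule.span k {a, b}) := by
  refine ⟨?_, ?_⟩
  · exact finrank_pair hi
  · intro v hv
    obtain ⟨x, y, rfl⟩ := Submodule.mem_span_pair.mp hv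
    have e1 := h.s2 a b a
    have e2 := h.s1 b a a
    have e3 := h.s2 b b a
    have e4 := h.s1 b a b
    simp only [map_add, map_smul, LinearMap.add_apply, LinearMap.smul_apply, smul_eq_mul]
    simp only [e3, e2, e4, e1, h1, h2, h3, h4]
    ring


lemma li3_iff {a b c : V} : LinearIndependent k ![a, b, c] ↔
    ∀ x y z : k, x • a + y • b + z • c = 0 → x = 0 ∧ y = 0 ∧ z = 0 := by
  rw [Fintype.linearIndependent_iff]
  constructor
  · intro h x y z hx
    have := h ![x, y, z] (by simpa [Fin.sum_univ_three] using hx)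
    exact ⟨this 0, this 1, this 2⟩
  · intro h g hg
    have := h (g 0) (g 1) (g 2) (by simpa [Fin.sum_univ_three] using hg)
    intro i
    fin_cases i
    exacts [this.1, this.2.1, this.2.2]

lemma li4_iff {a b c d : V} : LinearIndependent k ![a, b, c, d] ↔
    ∀ x y z t : k, x • a + y • b + z • c + t • d = 0 → x = 0 ∧ y = 0 ∧ z = 0 ∧ t = 0 := by
  rw [Fintype.linearIndependent_iff]
  constructor
  · intro h x y z t hx
    have := h ![x, y, z, t] (by simpa [Fin.sum_univ_four] using hx)
    exact ⟨this 0, this 1, this 2, this 3⟩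
  · intro h g hg
    have := h (g 0) (g 1) (g 2) (g 3) (by simpa [Fin.sum_univ_four] using hg)
    intro i
    fin_cases i
    exacts [this.1, this.2.1, this.2.2.1, this.2.2.2]

lemma span4 (hd : Module.finrank k V = 4) {a b c d : V}
    (h : LinearIndependent k ![a, b, c, d]) (v : V) :
    ∃ x y z t : k, v = x • a + y • b + z • c + t • d := by
  have hs := h.span_eq_top_of_card_eq_finrank (by simp [hd])
  have hv : v ∈ Submodule.span k (Set.range ![a, b, c, d]) := by rw [hs]; trivial
  obtain ⟨g, hg⟩ := (Submodule.mem_span_range_iff_exists_fun k).mp hv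
  exact ⟨g 0, g 1, g 2, g 3, by simpa [Fin.sum_univ_four] using hg.symm⟩

lemma extend3 (hd : Module.finrank k V = 4) {a b c : V} (h : LinearIndependent k ![a, b, c]) :
    ∃ d, LinearIndependent k ![a, b, c, d] := by
  obtain ⟨d, hh⟩ := exists_linearIndependent_snoc_of_lt_finrank h (by rw [hd]; norm_num)
  have e : Fin.snoc ![a, b, c] d = ![a, b, c, d] := by
    ext i; fin_cases i <;> rfl
  exact ⟨d, e ▸ hh⟩

lemma extend2 (hd : Module.finrank k V = 4) {a b : V} (h : LinearIndependent k ![a, b]) :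
    ∃ c, LinearIndependent k ![a, b, c] := by
  obtain ⟨d, hh⟩ := exists_linearIndependent_snoc_of_lt_finrank h (by rw [hd]; norm_num)
  have e : Fin.snoc ![a, b] d = ![a, b, d] := by
    ext i; fin_cases i <;> rfl
  exact ⟨d, e ▸ hh⟩

lemma exists_pair {W : Submodule k V} (h : Module.finrank k W = 2) :
    ∃ a b, LinearIndependent k ![a, b] ∧ W = Submodule.span k {a, b} := by
  have : FiniteDimensional k W := Module.finite_of_finrank_eq_succ h
  let B := Module.finBasisOfFinrankEq k W h
  refine ⟨B 0, B 1, ?_, ?_⟩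
  · rw [LinearIndependent.pair_iff]
    intro s t hst
    have h2 := LinearIndependent.pair_iff.mp
      (show LinearIndependent k ![B 0, B 1] by
        convert B.linearIndependent using 1; ext i; fin_cases i <;> rfl) s t
    exact h2 (by ext; simpa using hst)
  · apply le_antisymm
    · intro v hv
      rw [Submodule.mem_span_pair]
      have := B.sum_repr ⟨v, hv⟩
      rw [Fin.sum_univ_two] at this
      exact ⟨_, _, by simpa using congrArg Subtype.val this⟩
    · rw [Submodule.span_le]
      rintro x (rfl | rfl) <;> simp

/-- The key consequence of smoothness along a line. -/
lemma SC.keyS [IsAlgClosed k] (h : SC T) {P u w : V} (hi : LinearIndependent k ![P, u, w])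
    (h1 : T P P P = 0) (h2 : T P P u = 0) (h3 : T P u u = 0) (h4 : T u u u = 0)
    (h5 : T P P w = 0) (h6 : T P u w = 0) (h7 : T u u w = 0) : False := by
  obtain ⟨e, he⟩ := extend3 h.dim hi
  obtain ⟨x, y, hxy, hq⟩ := binary_quadratic_zero (T P P e) (2 * T P u e) (T u u e)
  have hv : x • P + y • u = 0 := by
    apply h.sm
    intro v
    obtain ⟨a, b, c, d, rfl⟩ := span4 h.dim he v
    simp only [map_add, map_smul, LinearMap.add_apply, LinearMap.smul_apply, smul_eq_mul,
      h.s1 u P, h.s2 P u P, h.s2 u u P, h1, h2, h3, h4, h5, h6, h7]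
    linear_combination d * hq
  have := li3_iff.mp hi x y 0 (by simpa using hv)
  tauto

end Setup

section Triangles
variable {k : Type} [Field k] {V : Type} [AddCommGroup V] [Module k V]
variable {T : V →ₗ[k] V →ₗ[k] V →ₗ[k] k}

lemma SC.fin (h : SC T) : FiniteDimensional k V := Module.finite_of_finrank_eq_succ h.dim

lemma eq_span_pair [FiniteDimensional k V] {W : Submodule k V} (hW : Module.finrank k W = 2)
    {a b : V} (ha : a ∈ W) (hb : b ∈ W) (hi : LinearIndependent k ![a, b]) :
    W = Submodule.span k {a, b} := by
  symm
  apply Submodule.eq_of_le_of_finrank_eq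
  · rw [Submodule.span_le]
    rintro x (rfl | rfl) <;> assumption
  · rw [finrank_pair hi, hW]

lemma exists_second [FiniteDimensional k V] {W : Submodule k V} (hW : Module.finrank k W = 2)
    {P : V} (hP : P ∈ W) (hP0 : P ≠ 0) :
    ∃ u ∈ W, LinearIndependent k ![P, u] ∧ W = Submodule.span k {P, u} := by
  have : ¬ W ≤ Submodule.span k {P} := by
    intro hle
    have := Submodule.finrank_mono hle
    rw [hW, finrank_span_singleton hP0] at this
    omega
  obtain ⟨u, hu, hu'⟩ := SetLike.not_le_iff_exists.mp this
  have hi : LinearIndependent k ![P, u] := by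
    rw [LinearIndependent.pair_iff' hP0]
    intro a ha
    exact hu' (Submodule.mem_span_singleton.mpr ⟨a, ha⟩)
  exact ⟨u, hu, hi, eq_span_pair hW hP hu hi⟩

lemma li3_of_notMem {P u w : V} (hi : LinearIndependent k ![P, u])
    (hw : w ∉ Submodule.span k {P, u}) : LinearIndependent k ![P, u, w] := by
  rw [li3_iff]
  intro x y z hx
  have hz : z = 0 := by
    by_contra hz
    apply hw
    rw [Submodule.mem_span_pair]
    refine ⟨-x / z, -y / z, ?_⟩
    have : w = z⁻¹ • (z • w) := by rw [smul_smul, inv_mul_cancel₀ hz, one_smul]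
    rw [this, show z • w = - (x • P + y • u) by rw [eq_neg_iff_add_eq_zero, ← hx]; abel]
    module
  subst hz
  have := LinearIndependent.pair_iff.mp hi x y (by simpa using hx)
  exact ⟨this.1, this.2, rfl⟩

lemma eq_of_le_line [FiniteDimensional k V] {W W' : Submodule k V} (hW : Module.finrank k W = 2)
    (hW' : Module.finrank k W' = 2) (h : W ≤ W') : W = W' :=
  Submodule.eq_of_le_of_finrank_eq h (by rw [hW, hW'])

lemma meet_basis [FiniteDimensional k V] {l m : Submodule k V} (hl : Module.finrank k l = 2)
    (hm : Module.finrank k m = 2) (hne : l ≠ m) (hmeet : l ⊓ m ≠ ⊥) :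
    ∃ P u w, LinearIndependent k ![P, u, w] ∧ l = Submodule.span k {P, u} ∧
      m = Submodule.span k {P, w} := by
  obtain ⟨P, hP, hP0⟩ := Submodule.exists_mem_ne_zero_of_ne_bot hmeet
  obtain ⟨hPl, hPm⟩ := Submodule.mem_inf.mp hP
  obtain ⟨u, hu, hiu, hlu⟩ := exists_second hl hPl hP0
  obtain ⟨w, hw, hiw, hmw⟩ := exists_second hm hPm hP0
  refine ⟨P, u, w, li3_of_notMem hiu ?_, hlu, hmw⟩
  intro hwl
  rw [← hlu] at hwl
  apply hne
  rw [hmw]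
  exact eq_span_pair hl hPl hwl hiw

lemma meet_of_le_three [FiniteDimensional k V] {l m H : Submodule k V}
    (hl : Module.finrank k l = 2)
    (hm : Module.finrank k m = 2) (hH : Module.finrank k H = 3) (h1 : l ≤ H) (h2 : m ≤ H) :
    l ⊓ m ≠ ⊥ := by
  intro hb
  have := Submodule.finrank_sup_add_finrank_inf_eq l m
  rw [hb, hl, hm, finrank_bot] at this
  have := Submodule.finrank_mono (sup_le h1 h2)
  omega

/-- Three coplanar lines on the surface. -/
structure Tri (T : V →ₗ[k] V →ₗ[k] V →ₗ[k] k) (l m n : Submodule k V) : Prop where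
  hl : LN T l
  hm : LN T m
  hn : LN T n
  lm : l ≠ m
  nl : n ≠ l
  nm : n ≠ m
  le : n ≤ l ⊔ m
  rk : Module.finrank k (l ⊔ m : Submodule k V) = 3
  pts : ∀ v ∈ l ⊔ m, T v v v = 0 → v ∈ l ∨ v ∈ m ∨ v ∈ n

lemma Tri.sup_eq [FiniteDimensional k V] {l m n : Submodule k V} (t : Tri T l m n) :
    l ⊔ n = l ⊔ m := by
  apply Submodule.eq_of_le_of_finrank_le
  · exact sup_le le_sup_left t.le
  · rw [t.rk]
    by_contra hc
    push Not at hc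
    have h1 : Module.finrank k (l ⊔ n : Submodule k V) ≤ 2 := by omega
    have e1 : l = l ⊔ n := Submodule.eq_of_le_of_finrank_le le_sup_left (by rw [t.hl.1]; exact h1)
    have : n ≤ l := by rw [e1]; exact le_sup_right
    exact t.nl (eq_of_le_line t.hn.1 t.hl.1 this)

lemma Tri.swap {l m n : Submodule k V} (t : Tri T l m n) : Tri T m l n where
  hl := t.hm
  hm := t.hl
  hn := t.hn
  lm := t.lm.symm
  nl := t.nm
  nm := t.nl
  le := by rw [sup_comm]; exact t.le
  rk := by rw [sup_comm]; exact t.rk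
  pts := by
    intro v hv h0
    rw [sup_comm] at hv
    have := t.pts v hv h0
    tauto

lemma Tri.rot [FiniteDimensional k V] {l m n : Submodule k V} (t : Tri T l m n) :
    Tri T l n m where
  hl := t.hl
  hm := t.hn
  hn := t.hm
  lm := t.nl.symm
  nl := t.lm.symm
  nm := t.nm.symm
  le := by rw [t.sup_eq]; exact le_sup_right
  rk := by rw [t.sup_eq]; exact t.rk
  pts := by
    intro v hv h0
    rw [t.sup_eq] at hv
    have := t.pts v hv h0
    tauto

/-- A subspace contained in the union of three subspaces is contained in one of them. -/
lemma le_of_union3 [CharZero k] {p a b c : Submodule k V}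
    (h : ∀ v ∈ p, v ∈ a ∨ v ∈ b ∨ v ∈ c) : p ≤ a ∨ p ≤ b ∨ p ≤ c := by
  have := Subspace.exists_eq_top_of_iUnion_eq_univ (k := k) (E := p)
    (p := fun i : Fin 3 => (![a, b, c] i).comap p.subtype) (by
      rw [Set.eq_univ_iff_forall]
      rintro ⟨v, hv⟩
      rw [Set.mem_iUnion]
      rcases h v hv with h | h | h
      exacts [⟨0, h⟩, ⟨1, h⟩, ⟨2, h⟩])
  obtain ⟨i, hi⟩ := this
  have key : p ≤ ![a, b, c] i := by
    rw [← Submodule.comap_subtype_eq_top]; exact hi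
  fin_cases i
  exacts [Or.inl key, Or.inr (Or.inl key), Or.inr (Or.inr key)]

/-- A line in the plane of a triangle is a side. -/
lemma Tri.side [FiniteDimensional k V] [CharZero k] {l m n p : Submodule k V} (t : Tri T l m n)
    (hp : LN T p) (hle : p ≤ l ⊔ m) : p = l ∨ p = m ∨ p = n := by
  rcases le_of_union3 (fun v hv => t.pts v (hle hv) (hp.2 v hv)) with h | h | h
  · exact Or.inl (eq_of_le_line hp.1 t.hl.1 h)
  · exact Or.inr (Or.inl (eq_of_le_line hp.1 t.hm.1 h))
  · exact Or.inr (Or.inr (eq_of_le_line hp.1 t.hn.1 h))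

lemma Tri.meet [FiniteDimensional k V] {l m n : Submodule k V} (t : Tri T l m n) :
    l ⊓ m ≠ ⊥ := meet_of_le_three t.hl.1 t.hm.1 t.rk le_sup_left le_sup_right

lemma SC.ker_rank (h : SC T) {v : V} (hv : v ≠ 0) :
    Module.finrank k (LinearMap.ker (T v v)) = 3 := by
  have := h.fin
  have hne : T v v ≠ 0 := fun h0 => hv (h.sm v (fun u => by rw [h0]; rfl))
  have h1 := LinearMap.finrank_range_add_finrank_ker (T v v)
  rw [LinearMap.range_eq_top.mpr (LinearMap.surjective hne), finrank_top, Module.finrank_self,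
    h.dim] at h1
  omega

/-- A line meeting two sides of a triangle lies in its plane. -/
lemma SC.two_meet [CharZero k] (h : SC T) {l m n p : Submodule k V} (t : Tri T l m n)
    (hp : LN T p) (h1 : p ⊓ l ≠ ⊥) (h2 : p ⊓ m ≠ ⊥) : p = l ∨ p = m ∨ p = n := by
  have := h.fin
  apply t.side hp
  obtain ⟨v, hv, hv0⟩ := Submodule.exists_mem_ne_zero_of_ne_bot h1
  obtain ⟨w, hw, hw0⟩ := Submodule.exists_mem_ne_zero_of_ne_bot h2
  obtain ⟨hvp, hvl⟩ := Submodule.mem_inf.mp hv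
  obtain ⟨hwp, hwm⟩ := Submodule.mem_inf.mp hw
  by_cases hi : LinearIndependent k ![v, w]
  · rw [eq_span_pair hp.1 hvp hwp hi, Submodule.span_le]
    rintro x (rfl | rfl)
    · exact Submodule.mem_sup_left hvl
    · exact Submodule.mem_sup_right hwm
  · rw [LinearIndependent.pair_iff' hv0] at hi
    push Not at hi
    obtain ⟨a, rfl⟩ := hi
    have ha : a ≠ 0 := by rintro rfl; simp at hw0
    have hvm : v ∈ m := (Submodule.smul_mem_iff _ ha).mp hwm
    have hk : ∀ q : Submodule k V, LN T q → v ∈ q → q ≤ LinearMap.ker (T v v) := by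
      intro q hq hvq x hx
      exact h.polar hq v hvq v hvq x hx
    have e : l ⊔ m = LinearMap.ker (T v v) := by
      apply Submodule.eq_of_le_of_finrank_eq (sup_le (hk l t.hl hvl) (hk m t.hm hvm))
      rw [t.rk, h.ker_rank hv0]
    rw [e]
    exact hk p hp hvp

/-- Every line meets some side of a triangle. -/
lemma SC.some_meet (h : SC T) {l m n p : Submodule k V} (t : Tri T l m n)
    (hp : LN T p) : p ⊓ l ≠ ⊥ ∨ p ⊓ m ≠ ⊥ ∨ p ⊓ n ≠ ⊥ := by
  have := h.fin
  have hb : p ⊓ (l ⊔ m) ≠ ⊥ := by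
    intro hb
    have e := Submodule.finrank_sup_add_finrank_inf_eq p (l ⊔ m)
    rw [hb, hp.1, t.rk, finrank_bot] at e
    have := Submodule.finrank_le (p ⊔ (l ⊔ m))
    rw [h.dim] at this
    omega
  obtain ⟨v, hv, hv0⟩ := Submodule.exists_mem_ne_zero_of_ne_bot hb
  obtain ⟨hvp, hvl⟩ := Submodule.mem_inf.mp hv
  have aux : ∀ q : Submodule k V, v ∈ q → p ⊓ q ≠ ⊥ := fun q hq hb =>
    hv0 ((Submodule.eq_bot_iff _).mp hb v (Submodule.mem_inf.mpr ⟨hvp, hq⟩))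
  rcases t.pts v hvl (hp.2 v hvp) with h | h | h
  · exact Or.inl (aux _ h)
  · exact Or.inr (Or.inl (aux _ h))
  · exact Or.inr (Or.inr (aux _ h))

/-- The third side of a triangle. -/
lemma SC.third [IsAlgClosed k] [CharZero k] (h : SC T) {l m : Submodule k V} (hl : LN T l)
    (hm : LN T m) (hne : l ≠ m) (hmeet : l ⊓ m ≠ ⊥) : ∃ n, Tri T l m n := by
  have := h.fin
  obtain ⟨P, u, w, hi, hlu, hmw⟩ := meet_basis hl.1 hm.1 hne hmeet
  have hPl : P ∈ l := by rw [hlu]; exact Submodule.subset_span (by simp)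
  have hul : u ∈ l := by rw [hlu]; exact Submodule.subset_span (by simp)
  have hPm : P ∈ m := by rw [hmw]; exact Submodule.subset_span (by simp)
  have hwm : w ∈ m := by rw [hmw]; exact Submodule.subset_span (by simp)
  have p1 := h.polar hl P hPl P hPl P hPl
  have p2 := h.polar hl P hPl P hPl u hul
  have p3 := h.polar hl P hPl u hul u hul
  have p4 := h.polar hl u hul u hul u hul
  have p5 := h.polar hm P hPm P hPm w hwm
  have p6 := h.polar hm P hPm w hwm w hwm
  have p7 := h.polar hm w hwm w hwm w hwm
  have hi' : LinearIndependent k ![P, w, u] := by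
    rw [li3_iff] at hi ⊢
    intro x y z hx
    have := hi x z y (by rw [← hx]; abel)
    tauto
  have ab : ¬ (T P u w = 0 ∧ T u u w = 0) := fun ⟨a, b⟩ => h.keyS hi p1 p2 p3 p4 p5 a b
  have ac : ¬ (T P u w = 0 ∧ T u w w = 0) := fun ⟨a, b⟩ =>
    h.keyS hi' p1 p5 p6 p7 p2 (by rw [h.s2]; exact a) (by rw [h.s2, h.s1, h.s2]; rw [h.s2]; exact b)
  set α := 2 * T P u w with hα
  set β := T u u w with hβ
  set γ := T u w w with hγ
  have cubic : ∀ a b c : k, T (a • P + b • u + c • w) (a • P + b • u + c • w)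
      (a • P + b • u + c • w) = 3 * b * c * (α * a + β * b + γ * c) := by
    intro a b c
    simp only [map_add, map_smul, LinearMap.add_apply, LinearMap.smul_apply, smul_eq_mul,
      h.s1 u P, h.s1 w P, h.s1 w u, h.s2 P u P, h.s2 P w P, h.s2 u u P, h.s2 u w P, h.s2 w w P,
      h.s2 u w u, h.s2 P w u, h.s2 w w u, p1, p2, p3, p4, p5, p6, p7, hα, hβ, hγ]
    ring
  let φ : (Fin 3 → k) →ₗ[k] V := Fintype.linearCombination k ![P, u, w]
  have hφ : ∀ g, φ g = g 0 • P + g 1 • u + g 2 • w := by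
    intro g; simp [φ, Fintype.linearCombination_apply, Fin.sum_univ_three]
  have hφi : Function.Injective φ := by
    rw [injective_iff_map_eq_zero]
    intro g hg
    rw [hφ] at hg
    obtain ⟨a, b, c⟩ := li3_iff.mp hi _ _ _ hg
    ext i; fin_cases i <;> assumption
  let f : (Fin 3 → k) →ₗ[k] k := Fintype.linearCombination k ![α, β, γ]
  have hf : ∀ g, f g = α * g 0 + β * g 1 + γ * g 2 := by
    intro g; simp [f, Fintype.linearCombination_apply, Fin.sum_univ_three]; ring
  have hf0 : f ≠ 0 := by
    intro h0
    apply ab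
    have e0 := hf ![1, 0, 0]
    have e1 := hf ![0, 1, 0]
    rw [h0] at e0 e1
    simp at e0 e1
    exact ⟨by simpa [hα] using e0, e1.symm⟩
  have hfr : Module.finrank k (LinearMap.ker f) = 2 := by
    have h1 := LinearMap.finrank_range_add_finrank_ker f
    rw [LinearMap.range_eq_top.mpr (LinearMap.surjective hf0), finrank_top, Module.finrank_self,
      Module.finrank_fin_fun] at h1
    omega
  have hsup : ∀ v, v ∈ l ⊔ m ↔ ∃ a b c : k, v = a • P + b • u + c • w := by
    intro v
    constructor
    · intro hv
      obtain ⟨x, hx, y, hy, rfl⟩ := Submodule.mem_sup.mp hv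
      rw [hlu] at hx; rw [hmw] at hy
      obtain ⟨a, b, rfl⟩ := Submodule.mem_span_pair.mp hx
      obtain ⟨c, d, rfl⟩ := Submodule.mem_span_pair.mp hy
      exact ⟨a + c, b, d, by module⟩
    · rintro ⟨a, b, c, rfl⟩
      exact Submodule.add_mem _ (Submodule.add_mem _
        (Submodule.smul_mem _ _ (Submodule.mem_sup_left hPl))
        (Submodule.smul_mem _ _ (Submodule.mem_sup_left hul)))
        (Submodule.smul_mem _ _ (Submodule.mem_sup_right hwm))
  have hn : ∀ a b c : k, a • P + b • u + c • w ∈ (LinearMap.ker f).map φ ↔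
      α * a + β * b + γ * c = 0 := by
    intro a b c
    have e : a • P + b • u + c • w = φ ![a, b, c] := by rw [hφ]; simp
    rw [e, Submodule.mem_map]
    constructor
    · rintro ⟨g, hg, hgg⟩
      rw [hφi hgg] at hg
      have := LinearMap.mem_ker.mp hg
      rw [hf] at this; simpa using this
    · intro h0
      exact ⟨_, by rw [LinearMap.mem_ker, hf]; simpa using h0, rfl⟩
  have hpu : LinearIndependent k ![P, u] := by
    rw [LinearIndependent.pair_iff]
    intro s t hst
    have := li3_iff.mp hi s t 0 (by simpa using hst)
    tauto
  refine ⟨(LinearMap.ker f).map φ, hl, hm, ⟨?_, ?_⟩, hne, ?_, ?_, ?_, ?_, ?_⟩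
  · rw [← hfr]
    exact (LinearEquiv.finrank_eq (Submodule.equivMapOfInjective φ hφi (LinearMap.ker f))).symm
  · intro v hv
    obtain ⟨g, hg, rfl⟩ := Submodule.mem_map.mp hv
    have := LinearMap.mem_ker.mp hg
    rw [hf] at this
    rw [hφ, cubic, this, mul_zero]
  · intro e
    have a1 := (hn 1 0 0).mp (by rw [e]; simpa using hPl)
    have a2 := (hn 0 1 0).mp (by rw [e]; simpa using hul)
    exact ab ⟨by simpa [hα] using a1, by simpa using a2⟩
  · intro e
    have a1 := (hn 1 0 0).mp (by rw [e]; simpa using hPm)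
    have a2 := (hn 0 0 1).mp (by rw [e]; simpa using hwm)
    exact ac ⟨by simpa [hα] using a1, by simpa using a2⟩
  · intro v hv
    obtain ⟨g, hg, rfl⟩ := Submodule.mem_map.mp hv
    exact (hsup _).mpr ⟨_, _, _, hφ g⟩
  · have : l ⊔ m = LinearMap.range φ := by
      ext v
      rw [hsup, LinearMap.mem_range]
      constructor
      · rintro ⟨a, b, c, rfl⟩
        exact ⟨![a, b, c], by rw [hφ]; simp⟩
      · rintro ⟨g, rfl⟩
        exact ⟨_, _, _, hφ g⟩
    rw [this, LinearMap.finrank_range_of_inj hφi, Module.finrank_fin_fun]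
  · intro v hv h0
    obtain ⟨a, b, c, rfl⟩ := (hsup v).mp hv
    rw [cubic] at h0
    rcases mul_eq_zero.mp h0 with h0 | h0
    · rcases mul_eq_zero.mp h0 with h0 | h0
      · have hb : b = 0 := by simpa using h0
        subst hb
        right; left
        rw [hmw, Submodule.mem_span_pair]
        exact ⟨a, c, by simp⟩
      · subst h0
        left
        rw [hlu, Submodule.mem_span_pair]
        exact ⟨a, b, by simp⟩
    · right; right
      exact (hn a b c).mpr h0

end Triangles

section Quintic
variable {k : Type} [Field k] {V : Type} [AddCommGroup V] [Module k V]
variable {T : V →ₗ[k] V →ₗ[k] V →ₗ[k] k}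

/-- Three times the discriminant of the residual conic in the plane spanned by `a`, `b`, `w`. -/
def Dl (T : V →ₗ[k] V →ₗ[k] V →ₗ[k] k) (a b w : V) : k :=
  4 * T a a w * T b b w * T w w w - 3 * T a a w * T b w w ^ 2 - 4 * T a b w ^ 2 * T w w w
    + 6 * T a b w * T a w w * T b w w - 3 * T b b w * T a w w ^ 2

/-- The trilinear form vanishes on the span of `a` and `b`. -/
structure Van (T : V →ₗ[k] V →ₗ[k] V →ₗ[k] k) (a b : V) : Prop where
  h1 : T a a a = 0
  h2 : T a a b = 0
  h3 : T a b b = 0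
  h4 : T b b b = 0

lemma Van.symm {a b : V} (h : SC T) (v : Van T a b) : Van T b a :=
  ⟨v.h4, by rw [h.s2, h.s1]; exact v.h3, by rw [h.s1, h.s2]; exact v.h2, v.h1⟩

lemma mem_sup_pair {a b w v : V} : v ∈ Submodule.span k {a, b} ⊔ Submodule.span k {w} ↔
    ∃ x y z : k, v = x • a + y • b + z • w := by
  constructor
  · intro hv
    obtain ⟨p, hp, q, hq, rfl⟩ := Submodule.mem_sup.mp hv
    obtain ⟨x, y, rfl⟩ := Submodule.mem_span_pair.mp hp
    obtain ⟨z, rfl⟩ := Submodule.mem_span_singleton.mp hq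
    exact ⟨x, y, z, rfl⟩
  · rintro ⟨x, y, z, rfl⟩
    exact Submodule.add_mem_sup (Submodule.mem_span_pair.mpr ⟨x, y, rfl⟩)
      (Submodule.mem_span_singleton.mpr ⟨z, rfl⟩)

lemma finrank_triple {a b w : V} (hi : LinearIndependent k ![a, b, w]) :
    Module.finrank k (Submodule.span k {a, b} ⊔ Submodule.span k {w} : Submodule k V) = 3 := by
  have e : Submodule.span k {a, b} ⊔ Submodule.span k {w} =
      Submodule.span k (Set.range ![a, b, w]) := by
    rw [← Submodule.span_union]
    congr 1
    ext x
    simp [eq_comm]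
    tauto
  rw [e, finrank_span_eq_card hi, Fintype.card_fin]

lemma li_pair_of_li3 {a b w : V} (hi : LinearIndependent k ![a, b, w]) :
    LinearIndependent k ![a, b] := by
  rw [LinearIndependent.pair_iff]
  intro s t hst
  have := li3_iff.mp hi s t 0 (by simpa using hst)
  tauto

lemma notMem_of_li3 {a b w : V} (hi : LinearIndependent k ![a, b, w]) :
    w ∉ Submodule.span k {a, b} := by
  intro hw
  obtain ⟨x, y, hxy⟩ := Submodule.mem_span_pair.mp hw
  have := li3_iff.mp hi x y (-1) (by rw [hxy]; module)
  simp at this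

lemma SC.line_of_conic [IsAlgClosed k] [CharZero k] (h : SC T) {a b w : V}
    (hi : LinearIndependent k ![a, b, w])
    (va : Van T a b) (x y z x' y' z' : k)
    (r1 : T a a w * x + T a b w * y + T a w w * z = 0)
    (r2 : T a b w * x + T b b w * y + T b w w * z = 0)
    (r3 : 3 * T a w w * x + 3 * T b w w * y + 4 * T w w w * z = 0)
    (q : 3 * T a a w * x' ^ 2 + 6 * T a b w * x' * y' + 3 * T b b w * y' ^ 2
      + 6 * T a w w * x' * z' + 6 * T b w w * y' * z' + 4 * T w w w * z' ^ 2 = 0)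
    (hli : ∀ s t : k, s * x + t * x' = 0 → s * y + t * y' = 0 → s * z + t * z' = 0 →
      s = 0 ∧ t = 0) :
    ∃ m, LN T m ∧ m ≠ Submodule.span k {a, b} ∧ m ⊓ Submodule.span k {a, b} ≠ ⊥ ∧
      m ≤ Submodule.span k {a, b} ⊔ Submodule.span k {w} := by
  have := h.fin
  obtain ⟨v, hv⟩ : ∃ v, v = x • a + y • b + (2 * z) • w := ⟨_, rfl⟩
  obtain ⟨v', hv'⟩ : ∃ v', v' = x' • a + y' • b + (2 * z') • w := ⟨_, rfl⟩
  have hvi : LinearIndependent k ![v, v'] := by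
    rw [LinearIndependent.pair_iff]
    intro s t hst
    have := li3_iff.mp hi (s * x + t * x') (s * y + t * y') (2 * (s * z + t * z')) (by
      rw [← hst, hv, hv']; module)
    exact hli s t this.1 this.2.1 (by simpa using this.2.2)
  have exps := And.intro (h.s1 b a) <| And.intro (h.s1 w a) <| And.intro (h.s1 w b) <|
    And.intro (h.s2 a b a) <| And.intro (h.s2 a w a) <| And.intro (h.s2 b b a) <|
    And.intro (h.s2 b w a) <| And.intro (h.s2 w w a) <| And.intro (h.s2 b w b) <|
    And.intro (h.s2 a w b) <| (h.s2 w w b)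
  have h3 : (3 : k) ≠ 0 := by norm_num
  have t1 : T v v v = 0 := by
    rw [hv]
    simp only [map_add, map_smul, LinearMap.add_apply, LinearMap.smul_apply, smul_eq_mul,
      exps, va.h1, va.h2, va.h3, va.h4]
    linear_combination 6 * z * (x * r1 + y * r2) + 2 * z ^ 2 * r3
  have t2 : T v v v' = 0 := by
    apply (mul_right_inj' h3).mp
    rw [hv, hv']
    simp only [map_add, map_smul, LinearMap.add_apply, LinearMap.smul_apply, smul_eq_mul,
      exps, va.h1, va.h2, va.h3, va.h4]
    linear_combination 2 * z' * (3 * x * r1 + 3 * y * r2 + z * r3) +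
      4 * z * (3 * x' * r1 + 3 * y' * r2 + z' * r3)
  have t3 : T v v' v' = 0 := by
    apply (mul_right_inj' h3).mp
    rw [hv, hv']
    simp only [map_add, map_smul, LinearMap.add_apply, LinearMap.smul_apply, smul_eq_mul,
      exps, va.h1, va.h2, va.h3, va.h4]
    linear_combination 2 * z * q + 4 * z' * (3 * x' * r1 + 3 * y' * r2 + z' * r3)
  have t4 : T v' v' v' = 0 := by
    rw [hv']
    simp only [map_add, map_smul, LinearMap.add_apply, LinearMap.smul_apply, smul_eq_mul,
      exps, va.h1, va.h2, va.h3, va.h4]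
    linear_combination 2 * z' * q
  have hm := LN_of_pair h hvi t1 t2 t3 t4
  have hle : Submodule.span k {v, v'} ≤ Submodule.span k {a, b} ⊔ Submodule.span k {w} := by
    rw [Submodule.span_le]
    rintro u (rfl | rfl)
    · exact mem_sup_pair.mpr ⟨_, _, _, hv⟩
    · exact mem_sup_pair.mpr ⟨_, _, _, hv'⟩
  refine ⟨_, hm, ?_, ?_, hle⟩
  · intro e
    have hz : ∀ (x y z : k), x • a + y • b + (2 * z) • w ∈ Submodule.span k {a, b} → z = 0 := by
      intro x y z hxy
      obtain ⟨s, t, hst⟩ := Submodule.mem_span_pair.mp hxy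
      have := li3_iff.mp hi (x - s) (y - t) (2 * z) (by
        rw [show (x - s) • a + (y - t) • b + (2 * z) • w = x • a + y • b + (2 * z) • w -
          (s • a + t • b) by module, hst, sub_self])
      simpa using this.2.2
    have z0 : z = 0 := hz x y z (by rw [← hv, ← e]; exact Submodule.subset_span (by simp))
    have z0' : z' = 0 := hz x' y' z' (by rw [← hv', ← e]; exact Submodule.subset_span (by simp))
    have hwi : LinearIndependent k ![v, v', w] := li3_of_notMem hvi (by
      rw [e]; exact notMem_of_li3 hi)
    subst z0 z0'
    refine h.keyS hwi t1 t2 t3 t4 ?_ ?_ ?_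
    · rw [hv]
      simp only [map_add, map_smul, LinearMap.add_apply, LinearMap.smul_apply, smul_eq_mul,
        exps]
      linear_combination x * r1 + y * r2
    · rw [hv, hv']
      simp only [map_add, map_smul, LinearMap.add_apply, LinearMap.smul_apply, smul_eq_mul,
        exps]
      linear_combination x' * r1 + y' * r2
    · apply (mul_right_inj' h3).mp
      rw [hv']
      simp only [map_add, map_smul, LinearMap.add_apply, LinearMap.smul_apply, smul_eq_mul,
        exps]
      linear_combination q
  · exact meet_of_le_three hm.1 (finrank_pair (li_pair_of_li3 hi)) (finrank_triple hi) hle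
      le_sup_left

lemma Dl_kernel {a b w : V} (hD : Dl T a b w = 0) : ∃ x y z : k, (x ≠ 0 ∨ y ≠ 0 ∨ z ≠ 0) ∧
    T a a w * x + T a b w * y + T a w w * z = 0 ∧
    T a b w * x + T b b w * y + T b w w * z = 0 ∧
    3 * T a w w * x + 3 * T b w w * y + 4 * T w w w * z = 0 := by
  have hdet : Matrix.det !![T a a w, T a b w, T a w w; T a b w, T b b w, T b w w;
      3 * T a w w, 3 * T b w w, 4 * T w w w] = 0 := by
    rw [Matrix.det_fin_three]
    simp
    rw [← hD, Dl]; ring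
  obtain ⟨v, hv, hM⟩ := Matrix.exists_mulVec_eq_zero_iff.mpr hdet
  refine ⟨v 0, v 1, v 2, ?_, ?_, ?_, ?_⟩
  · by_contra hc
    push Not at hc
    apply hv
    ext i; fin_cases i
    exacts [hc.1, hc.2.1, hc.2.2]
  · simpa [Matrix.mulVec, dotProduct, Fin.sum_univ_three] using congrFun hM 0
  · simpa [Matrix.mulVec, dotProduct, Fin.sum_univ_three] using congrFun hM 1
  · simpa [Matrix.mulVec, dotProduct, Fin.sum_univ_three] using congrFun hM 2

lemma SC.line_of_Dl [IsAlgClosed k] [CharZero k] (h : SC T) {a b w : V}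
    (hi : LinearIndependent k ![a, b, w])
    (va : Van T a b) (hD : Dl T a b w = 0) :
    ∃ m, LN T m ∧ m ≠ Submodule.span k {a, b} ∧ m ⊓ Submodule.span k {a, b} ≠ ⊥ ∧
      m ≤ Submodule.span k {a, b} ⊔ Submodule.span k {w} := by
  obtain ⟨x, y, z, hne, r1, r2, r3⟩ := Dl_kernel hD
  by_cases hz : z = 0
  · subst hz
    by_cases hx : x = 0
    · subst hx
      have hy : y ≠ 0 := by simpa using hne
      obtain ⟨s, t, hst, hq⟩ := binary_quadratic_zero (3 * T a a w) (6 * T a w w) (4 * T w w w)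
      refine h.line_of_conic hi va 0 y 0 s 0 t r1 r2 r3 (by linear_combination hq) ?_
      intro p q e1 e2 e3
      have hp : p = 0 := by simpa [hy] using e2
      have e1' : q = 0 ∨ s = 0 := by simpa using e1
      have e3' : q = 0 ∨ t = 0 := by simpa using e3
      tauto
    · obtain ⟨s, t, hst, hq⟩ := binary_quadratic_zero (3 * T b b w) (6 * T b w w) (4 * T w w w)
      refine h.line_of_conic hi va x y 0 0 s t r1 r2 r3 (by linear_combination hq) ?_
      intro p q e1 e2 e3
      have hp : p = 0 := by simpa [hx] using e1
      subst hp
      have e1' : q = 0 ∨ s = 0 := by simpa using e2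
      have e3' : q = 0 ∨ t = 0 := by simpa using e3
      tauto
  · obtain ⟨s, t, hst, hq⟩ := binary_quadratic_zero (3 * T a a w) (6 * T a b w) (3 * T b b w)
    refine h.line_of_conic hi va x y z s t 0 r1 r2 r3 (by linear_combination hq) ?_
    intro p q e1 e2 e3
    have hp : p = 0 := by simpa [hz] using e3
    subst hp
    have e1' : q = 0 ∨ s = 0 := by simpa using e1
    have e3' : q = 0 ∨ t = 0 := by simpa using e2
    tauto

lemma SC.Dl_of_line [CharZero k] (h : SC T) {a b w : V}
    (hi : LinearIndependent k ![a, b, w])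
    (va : Van T a b) {m : Submodule k V} (hm : LN T m) (hne : m ≠ Submodule.span k {a, b})
    (hmeet : m ⊓ Submodule.span k {a, b} ≠ ⊥)
    (hle : m ≤ Submodule.span k {a, b} ⊔ Submodule.span k {w}) : Dl T a b w = 0 := by
  have := h.fin
  obtain ⟨P, hP, hP0⟩ := Submodule.exists_mem_ne_zero_of_ne_bot hmeet
  obtain ⟨hPm, hPl⟩ := Submodule.mem_inf.mp hP
  have : ¬ m ≤ Submodule.span k {a, b} := fun hh =>
    hne (eq_of_le_line hm.1 (finrank_pair (li_pair_of_li3 hi)) hh)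
  obtain ⟨v, hvm, hvl⟩ := SetLike.not_le_iff_exists.mp this
  obtain ⟨p, q, rfl⟩ := Submodule.mem_span_pair.mp hPl
  obtain ⟨x, y, z, rfl⟩ := mem_sup_pair.mp (hle hvm)
  have hz : z ≠ 0 := by
    rintro rfl
    exact hvl (Submodule.mem_span_pair.mpr ⟨x, y, by simp⟩)
  have t1 := h.polar hm _ hPm _ hPm _ hvm
  have t2 := h.polar hm _ hPm _ hvm _ hvm
  have t3 := h.polar hm _ hvm _ hvm _ hvm
  simp only [map_add, map_smul, LinearMap.add_apply, LinearMap.smul_apply, smul_eq_mul,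
      va.h1, va.h2, va.h3, va.h4, h.s1 b a, h.s1 w a, h.s1 w b, h.s2 a b a, h.s2 a w a,
      h.s2 b b a, h.s2 b w a, h.s2 w w a, h.s2 b w b, h.s2 a w b, h.s2 w w b] at t1 t2 t3
  generalize hA : T a a w = A at *
  generalize hB : T a b w = B at *
  generalize hC : T b b w = C at *
  generalize hD : T a w w = D at *
  generalize hE : T b w w = E at *
  generalize hG : T w w w = G at *
  have s1 : A * p ^ 2 + 2 * B * p * q + C * q ^ 2 = 0 := by
    apply (mul_right_inj' hz).mp; linear_combination t1
  have s2 : 2 * (p * (A * x + B * y) + q * (B * x + C * y)) + z * (p * D + q * E) = 0 := by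
    apply (mul_right_inj' hz).mp; linear_combination t2
  have s3 : 3 * (A * x ^ 2 + 2 * B * x * y + C * y ^ 2) + 3 * z * (x * D + y * E)
      + z ^ 2 * G = 0 := by
    apply (mul_right_inj' hz).mp; linear_combination t3
  simp only [Dl, hA, hB, hC, hD, hE, hG]
  have hpq : p ≠ 0 ∨ q ≠ 0 := by
    by_contra hc
    push Not at hc
    apply hP0
    simp [hc]
  -- Gram determinants in the bases (a, P, v) and (b, P, v)
  have e1 : q ^ 2 * z ^ 2 * (4 * A * C * G - 3 * A * E ^ 2 - 4 * B ^ 2 * G + 6 * B * D * E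
      - 3 * C * D ^ 2) = 0 := by
    have g1 : q ^ 2 * z ^ 2 * (4 * A * C * G - 3 * A * E ^ 2 - 4 * B ^ 2 * G + 6 * B * D * E
      - 3 * C * D ^ 2) =
      4 * A * (A * p ^ 2 + 2 * B * p * q + C * q ^ 2) *
        (3 * (A * x ^ 2 + 2 * B * x * y + C * y ^ 2) + 3 * z * (x * D + y * E) + z ^ 2 * G)
      - 3 * A * (2 * (p * (A * x + B * y) + q * (B * x + C * y)) + z * (p * D + q * E)) ^ 2
      - 4 * (A * p + B * q) ^ 2 *
        (3 * (A * x ^ 2 + 2 * B * x * y + C * y ^ 2) + 3 * z * (x * D + y * E) + z ^ 2 * G)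
      + 6 * (A * p + B * q) * (2 * (A * x + B * y) + z * D) *
        (2 * (p * (A * x + B * y) + q * (B * x + C * y)) + z * (p * D + q * E))
      - 3 * (A * p ^ 2 + 2 * B * p * q + C * q ^ 2) * (2 * (A * x + B * y) + z * D) ^ 2 := by
      ring
    rw [g1, s1, s2, s3]; ring
  have e2 : p ^ 2 * z ^ 2 * (4 * A * C * G - 3 * A * E ^ 2 - 4 * B ^ 2 * G + 6 * B * D * E
      - 3 * C * D ^ 2) = 0 := by
    have g1 : p ^ 2 * z ^ 2 * (4 * A * C * G - 3 * A * E ^ 2 - 4 * B ^ 2 * G + 6 * B * D * E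
      - 3 * C * D ^ 2) =
      4 * C * (A * p ^ 2 + 2 * B * p * q + C * q ^ 2) *
        (3 * (A * x ^ 2 + 2 * B * x * y + C * y ^ 2) + 3 * z * (x * D + y * E) + z ^ 2 * G)
      - 3 * C * (2 * (p * (A * x + B * y) + q * (B * x + C * y)) + z * (p * D + q * E)) ^ 2
      - 4 * (B * p + C * q) ^ 2 *
        (3 * (A * x ^ 2 + 2 * B * x * y + C * y ^ 2) + 3 * z * (x * D + y * E) + z ^ 2 * G)
      + 6 * (B * p + C * q) * (2 * (B * x + C * y) + z * E) *
        (2 * (p * (A * x + B * y) + q * (B * x + C * y)) + z * (p * D + q * E))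
      - 3 * (A * p ^ 2 + 2 * B * p * q + C * q ^ 2) * (2 * (B * x + C * y) + z * E) ^ 2 := by
      ring
    rw [g1, s1, s2, s3]; ring
  rcases hpq with hp | hp
  · simpa [hp, hz] using e2
  · simpa [hp, hz] using e1

end Quintic

section Simple
variable {k : Type} [Field k] {V : Type} [AddCommGroup V] [Module k V]
variable {T : V →ₗ[k] V →ₗ[k] V →ₗ[k] k}

/-- The residual conic is never a double line. -/
lemma SC.no_double [IsAlgClosed k] [CharZero k] (h : SC T) {a b w : V}
    (hi : LinearIndependent k ![a, b, w]) (va : Van T a b) (hA : T a a w ≠ 0)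
    (m33 : T a a w * T b b w = T a b w ^ 2)
    (m23 : T a b w * T a w w = T a a w * T b w w)
    (m22 : 4 * T a a w * T w w w = 3 * T a w w ^ 2) : False := by
  have h3 : (3 : k) ≠ 0 := by norm_num
  obtain ⟨P, hP⟩ : ∃ P, P = (-T a b w) • a + (T a a w) • b := ⟨_, rfl⟩
  obtain ⟨v, hv⟩ : ∃ v, v = (-T a w w) • a + (2 * T a a w) • w := ⟨_, rfl⟩
  have hli : LinearIndependent k ![P, v, a] := by
    rw [li3_iff]
    intro x y z hx
    have := li3_iff.mp hi (z - x * T a b w - y * T a w w) (x * T a a w) (2 * y * T a a w) (by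
      rw [← hx, hP, hv]; module)
    obtain ⟨e1, e2, e3⟩ := this
    have hx : x = 0 := by simpa [hA] using e2
    have hy : y = 0 := by simpa [hA] using e3
    subst hx hy
    exact ⟨rfl, rfl, by simpa using e1⟩
  have exps := And.intro (h.s1 b a) <| And.intro (h.s1 w a) <| And.intro (h.s1 w b) <|
    And.intro (h.s2 a b a) <| And.intro (h.s2 a w a) <| And.intro (h.s2 b b a) <|
    And.intro (h.s2 b w a) <| And.intro (h.s2 w w a) <| And.intro (h.s2 b w b) <|
    And.intro (h.s2 a w b) <| (h.s2 w w b)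
  have v1 := va.h1
  have v2 := va.h2
  have v3 := va.h3
  have v4 := va.h4
  apply h.keyS hli
  all_goals
    simp only [hP, hv, map_add, map_smul, LinearMap.add_apply, LinearMap.smul_apply, smul_eq_mul,
      exps, v1, v2, v3, v4]
  · ring
  · linear_combination 2 * T a a w ^ 2 * m33
  · linear_combination -4 * T a a w ^ 2 * m23
  · linear_combination 2 * T a a w ^ 2 * m22
  · ring
  · ring
  · ring

lemma scalar_simple [CharZero k] {A B C D E G A' B' C' D' E' G' x y z : k}
    (r1 : A * x + B * y + D * z = 0)
    (r2 : B * x + C * y + E * z = 0)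
    (r3 : 3 * D * x + 3 * E * y + 4 * G * z = 0)
    (hd : A' * (4 * C * G - 3 * E ^ 2) + C' * (4 * A * G - 3 * D ^ 2) + 4 * G' * (A * C - B ^ 2)
      + 2 * B' * (3 * D * E - 4 * B * G) + 6 * D' * (B * E - C * D) + 6 * E' * (B * D - A * E) = 0)
    (hK : 3 * x ^ 2 * A' + 6 * x * y * B' + 3 * y ^ 2 * C' + 6 * z * (x * D' + y * E')
      + 4 * z ^ 2 * G' ≠ 0) :
    4 * C * G - 3 * E ^ 2 = 0 ∧ A * C - B ^ 2 = 0 := by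
  have p12 : x * (3 * D * E - 4 * B * G) - y * (4 * C * G - 3 * E ^ 2) = 0 := by
    linear_combination -4 * G * r2 + E * r3
  have p13 : 3 * x * (B * E - C * D) - z * (4 * C * G - 3 * E ^ 2) = 0 := by
    linear_combination 3 * E * r2 - C * r3
  have p22 : x * (4 * A * G - 3 * D ^ 2) - y * (3 * D * E - 4 * B * G) = 0 := by
    linear_combination 4 * G * r1 - D * r3
  have p23 : 3 * x * (B * D - A * E) - z * (3 * D * E - 4 * B * G) = 0 := by
    linear_combination -3 * E * r1 + B * r3
  have p33 : x * (A * C - B ^ 2) - z * (B * E - C * D) = 0 := by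
    linear_combination C * r1 - B * r2
  have q33 : y * (A * C - B ^ 2) - z * (B * D - A * E) = 0 := by
    linear_combination A * r2 - B * r1
  have q23 : 3 * y * (B * D - A * E) - z * (4 * A * G - 3 * D ^ 2) = 0 := by
    linear_combination 3 * D * r1 - A * r3
  constructor
  · apply (mul_left_inj' hK).mp
    linear_combination 3 * x ^ 2 * hd - (3 * C' * (x * p22 + y * p12) + 4 * G' * (3 * x * p33
      + z * p13) + 6 * B' * x * p12 + 6 * D' * x * p13 + 6 * E' * (x * p23 + z * p12))
  · apply (mul_left_inj' hK).mp
    linear_combination z ^ 2 * hd - (A' * (-z * p13 - 3 * x * p33) + C' * (-z * q23 - 3 * y * q33)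
      + 2 * B' * (-z * p23 - 3 * x * q33) + 6 * D' * (-z * p33) + 6 * E' * (-z * q33))

/-- The derivative of `Dl` at `w` in the direction `e`. -/
def dDl (T : V →ₗ[k] V →ₗ[k] V →ₗ[k] k) (a b w e : V) : k :=
  T a a e * (4 * T b b w * T w w w - 3 * T b w w ^ 2)
  + T b b e * (4 * T a a w * T w w w - 3 * T a w w ^ 2)
  + 4 * (3 * T w w e) * (T a a w * T b b w - T a b w ^ 2)
  + 2 * T a b e * (3 * T a w w * T b w w - 4 * T a b w * T w w w)
  + 6 * (2 * T a w e) * (T a b w * T b w w - T b b w * T a w w)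
  + 6 * (2 * T b w e) * (T a b w * T a w w - T a a w * T b w w)

lemma SC.simple [IsAlgClosed k] [CharZero k] (h : SC T) {a b w e : V}
    (hi : LinearIndependent k ![a, b, w, e]) (va : Van T a b) (hD : Dl T a b w = 0) :
    dDl T a b w e ≠ 0 := by
  intro hd
  obtain ⟨x, y, z, hne, r1, r2, r3⟩ := Dl_kernel hD
  have hi3 : LinearIndependent k ![a, b, w] := by
    rw [li3_iff]
    intro x y z hx
    have := li4_iff.mp hi x y z 0 (by simpa using hx)
    tauto
  have exps := And.intro (h.s1 b a) <| And.intro (h.s1 w a) <| And.intro (h.s1 w b) <|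
    And.intro (h.s2 a b a) <| And.intro (h.s2 a w a) <| And.intro (h.s2 b b a) <|
    And.intro (h.s2 b w a) <| And.intro (h.s2 w w a) <| And.intro (h.s2 b w b) <|
    And.intro (h.s2 a w b) <| (h.s2 w w b)
  have v1 := va.h1
  have v2 := va.h2
  have v3 := va.h3
  have v4 := va.h4
  have hK : 3 * x ^ 2 * T a a e + 6 * x * y * T a b e + 3 * y ^ 2 * T b b e
      + 6 * z * (x * (2 * T a w e) + y * (2 * T b w e)) + 4 * z ^ 2 * (3 * T w w e) ≠ 0 := by
    intro hK
    have hv : x • a + y • b + (2 * z) • w = 0 := by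
      apply h.sm
      intro u
      obtain ⟨p, q, r, s, rfl⟩ := span4 h.dim hi u
      have h3 : (3 : k) ≠ 0 := by norm_num
      apply (mul_right_inj' h3).mp
      simp only [map_add, map_smul, LinearMap.add_apply, LinearMap.smul_apply, smul_eq_mul,
        exps, v1, v2, v3, v4]
      linear_combination s * hK + p * (12 * z * r1) + q * (12 * z * r2) +
        r * (3 * x * r1 + 3 * y * r2 + 3 * z * r3)
    have := li3_iff.mp hi3 _ _ _ hv
    simp at this
    tauto
  obtain ⟨m11, m33⟩ := scalar_simple r1 r2 r3 hd hK
  obtain ⟨m22, -⟩ := scalar_simple (A := T b b w) (B := T a b w) (C := T a a w) (D := T b w w)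
    (E := T a w w) (G := T w w w) (A' := T b b e) (B' := T a b e) (C' := T a a e)
    (D' := 2 * T b w e) (E' := 2 * T a w e) (G' := 3 * T w w e) (x := y) (y := x) (z := z)
    (by linear_combination r2) (by linear_combination r1) (by linear_combination r3)
    (by rw [dDl] at hd; linear_combination hd) (by
      intro h0; apply hK; linear_combination h0)
  rw [Dl] at hD
  have h3 : (3 : k) ≠ 0 := by norm_num
  have m23 : T a b w * T a w w - T a a w * T b w w = 0 := by
    apply pow_eq_zero_iff (two_ne_zero) |>.mp
    apply (mul_right_inj' h3).mp
    linear_combination m22 * (T a a w * T b b w - T a b w ^ 2) - T a a w * hD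
  have m13 : T a b w * T b w w - T b b w * T a w w = 0 := by
    apply pow_eq_zero_iff (two_ne_zero) |>.mp
    apply (mul_right_inj' h3).mp
    linear_combination m11 * (T a a w * T b b w - T a b w ^ 2) - T b b w * hD
  by_cases hA : T a a w = 0
  · by_cases hC : T b b w = 0
    · have hB : T a b w = 0 := by
        rw [hA] at m33
        simpa using m33
      exact h.keyS hi3 v1 v2 v3 v4 hA hB hC
    · have hi3' : LinearIndependent k ![b, a, w] := by
        rw [li3_iff]
        intro x y z hx
        have := li3_iff.mp hi3 y x z (by rw [← hx]; abel)
        tauto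
      have hs := h.s1 b a w
      exact h.no_double hi3' (va.symm h) hC (by rw [hs]; linear_combination m33)
        (by rw [hs]; linear_combination m13) (by linear_combination m11)
  · exact h.no_double hi3 va hA (by linear_combination m33) (by linear_combination m23)
      (by linear_combination m22)

end Simple

section Five
variable {k : Type} [Field k] {V : Type} [AddCommGroup V] [Module k V]
variable {T : V →ₗ[k] V →ₗ[k] V →ₗ[k] k}

/-- `p` has degree at most `n` and coefficient `c` in degree `n`. -/
def Tp (p : Polynomial k) (n : ℕ) (c : k) : Prop := p.natDegree ≤ n ∧ p.coeff n = c

lemma Tp.mul {p q : Polynomial k} {n m : ℕ} {c d : k} (hp : Tp p n c) (hq : Tp q m d) :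
    Tp (p * q) (n + m) (c * d) :=
  ⟨(Polynomial.natDegree_mul_le).trans (Nat.add_le_add hp.1 hq.1), by
    rw [Polynomial.coeff_mul_add_eq_of_natDegree_le hp.1 hq.1, hp.2, hq.2]⟩

lemma Tp.add {p q : Polynomial k} {n : ℕ} {c d : k} (hp : Tp p n c) (hq : Tp q n d) :
    Tp (p + q) n (c + d) :=
  ⟨Polynomial.natDegree_add_le_of_degree_le hp.1 hq.1, by
    rw [Polynomial.coeff_add, hp.2, hq.2]⟩

lemma Tp.sub {p q : Polynomial k} {n : ℕ} {c d : k} (hp : Tp p n c) (hq : Tp q n d) :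
    Tp (p - q) n (c - d) :=
  ⟨Polynomial.natDegree_sub_le_of_le hp.1 hq.1 |>.trans (by simp), by
    rw [Polynomial.coeff_sub, hp.2, hq.2]⟩

lemma Tp.const (c : k) : Tp (Polynomial.C c) 0 c := ⟨by simp, by simp⟩

lemma Tp.xpow (n : ℕ) : Tp (Polynomial.X ^ n : Polynomial k) n 1 := ⟨by simp, by simp⟩

lemma Tp.lift {p : Polynomial k} {n : ℕ} {c : k} (hp : Tp p n c) {m : ℕ} (h : n < m) :
    Tp p m 0 :=
  ⟨hp.1.trans h.le, Polynomial.coeff_eq_zero_of_natDegree_lt (lt_of_le_of_lt hp.1 h)⟩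

lemma Tp.pow {p : Polynomial k} {n : ℕ} {c : k} (hp : Tp p n c) (m : ℕ) :
    Tp (p ^ m) (m * n) (c ^ m) :=
  ⟨Polynomial.natDegree_pow_le_of_le m hp.1, by
    rw [Polynomial.coeff_pow_of_natDegree_le hp.1, hp.2]⟩

lemma Dl_poly (h : SC T) (a b e f : V) : ∃ δ : Polynomial k, Tp δ 5 (Dl T a b f) ∧
    (∀ s, δ.eval s = Dl T a b (e + s • f)) ∧
    (∀ s, δ.derivative.eval s = dDl T a b (e + s • f) f) := by
  let lin : k → k → Polynomial k := fun p q => Polynomial.C q * Polynomial.X ^ 1 + Polynomial.C p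
  let quad : k → k → k → Polynomial k := fun p q r => Polynomial.C r * Polynomial.X ^ 2 + (Polynomial.C (2 * q) * Polynomial.X ^ 1 + Polynomial.C p)
  let cub : k → k → k → k → Polynomial k := fun p q r s =>
    Polynomial.C s * Polynomial.X ^ 3 + (Polynomial.C (3 * r) * Polynomial.X ^ 2 + (Polynomial.C (3 * q) * Polynomial.X ^ 1 + Polynomial.C p))
  have tl : ∀ p q, Tp (lin p q) 1 q := fun p q => by
    have := ((Tp.const q).mul (Tp.xpow 1)).add ((Tp.const p).lift (m := 0 + 1) (by norm_num))
    simpa [lin] using this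
  have tq : ∀ p q r, Tp (quad p q r) 2 r := fun p q r => by
    have := ((Tp.const r).mul (Tp.xpow 2)).add
      ((((Tp.const (2 * q)).mul (Tp.xpow 1)).lift (m := 0 + 2) (by norm_num)).add
        ((Tp.const p).lift (m := 0 + 2) (by norm_num)))
    simpa [quad] using this
  have tc : ∀ p q r s, Tp (cub p q r s) 3 s := fun p q r s => by
    have := ((Tp.const s).mul (Tp.xpow 3)).add
      ((((Tp.const (3 * r)).mul (Tp.xpow 2)).lift (m := 0 + 3) (by norm_num)).add
      ((((Tp.const (3 * q)).mul (Tp.xpow 1)).lift (m := 0 + 3) (by norm_num)).add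
        ((Tp.const p).lift (m := 0 + 3) (by norm_num))))
    simpa [cub] using this
  let A := lin (T a a e) (T a a f)
  let B := lin (T a b e) (T a b f)
  let G := lin (T b b e) (T b b f)
  let D := quad (T a e e) (T a e f) (T a f f)
  let E := quad (T b e e) (T b e f) (T b f f)
  let H := cub (T e e e) (T e e f) (T e f f) (T f f f)
  have tA : Tp A 1 _ := tl _ _
  have tB : Tp B 1 _ := tl _ _
  have tG : Tp G 1 _ := tl _ _
  have tD : Tp D 2 _ := tq _ _ _
  have tE : Tp E 2 _ := tq _ _ _
  have tH : Tp H 3 _ := tc _ _ _ _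
  refine ⟨Polynomial.C 4 * A * G * H - Polynomial.C 3 * A * E ^ 2 - Polynomial.C 4 * B ^ 2 * H + Polynomial.C 6 * B * D * E
    - Polynomial.C 3 * G * D ^ 2, ?_, ?_, ?_⟩
  · have := (((((((Tp.const 4).mul tA).mul tG).mul tH).sub
      (((Tp.const 3).mul tA).mul (tE.pow 2))).sub
      (((Tp.const 4).mul (tB.pow 2)).mul tH)).add
      ((((Tp.const 6).mul tB).mul tD).mul tE)).sub (((Tp.const 3).mul tG).mul (tD.pow 2))
    exact this
  · intro s
    simp only [Dl, A, B, G, D, E, H, lin, quad, cub]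
    simp only [Polynomial.eval_add, Polynomial.eval_sub, Polynomial.eval_mul, Polynomial.eval_C, Polynomial.eval_pow, Polynomial.eval_X,
      map_add, map_smul, LinearMap.add_apply, LinearMap.smul_apply, smul_eq_mul,
      h.s1 f e, h.s2 a f e, h.s2 b f e, h.s2 e f e, h.s2 f f e]
    ring
  · intro s
    simp only [dDl, A, B, G, D, E, H, lin, quad, cub]
    simp only [Polynomial.derivative_add, Polynomial.derivative_sub, Polynomial.derivative_mul, Polynomial.derivative_C, Polynomial.derivative_pow,
      Polynomial.derivative_X]
    simp only [Polynomial.eval_add, Polynomial.eval_sub, Polynomial.eval_mul, Polynomial.eval_C, Polynomial.eval_pow, Polynomial.eval_X, Polynomial.eval_one, Polynomial.eval_zero,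
      map_add, map_smul, LinearMap.add_apply, LinearMap.smul_apply, smul_eq_mul,
      h.s1 f e, h.s2 a f e, h.s2 b f e, h.s2 e f e, h.s2 f f e]
    norm_num
    ring

lemma Dl_smul (a b w : V) (c : k) : Dl T a b (c • w) = c ^ 5 * Dl T a b w := by
  simp only [Dl, map_smul, LinearMap.smul_apply, smul_eq_mul]
  ring

/-- The five triangles through a line. -/
lemma SC.five [IsAlgClosed k] [CharZero k] (h : SC T) {l : Submodule k V} (hl : LN T l) :
    ∃ m m' : Fin 5 → Submodule k V, (∀ i, Tri T l (m i) (m' i)) ∧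
      (∀ i j, i ≠ j → m i ≠ m j ∧ m i ≠ m' j ∧ m' i ≠ m' j) ∧
      ∀ x, LN T x → x ≠ l → x ⊓ l ≠ ⊥ → ∃ i, x = m i ∨ x = m' i := by
  classical
  have := h.fin
  obtain ⟨a, b, hab, hlab⟩ := exists_pair hl.1
  have ha : a ∈ l := by rw [hlab]; exact Submodule.subset_span (by simp)
  have hb : b ∈ l := by rw [hlab]; exact Submodule.subset_span (by simp)
  have va : Van T a b := ⟨h.polar hl a ha a ha a ha, h.polar hl a ha a ha b hb,
    h.polar hl a ha b hb b hb, h.polar hl b hb b hb b hb⟩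
  -- a basis whose last vector has nonzero discriminant
  obtain ⟨e, f, hi, hf⟩ : ∃ e f, LinearIndependent k ![a, b, e, f] ∧ Dl T a b f ≠ 0 := by
    obtain ⟨c, hc⟩ := extend2 h.dim hab
    obtain ⟨d, hd⟩ := extend3 h.dim hc
    obtain ⟨δ, -, d1, d2⟩ := Dl_poly h a b c d
    by_contra hcon
    push Not at hcon
    have hz : ∀ s : k, Dl T a b (c + s • d) = 0 := by
      intro s
      apply hcon d
      rw [li4_iff] at hd ⊢
      intro x y z t hx
      have := hd x y t (z + t * s) (by rw [← hx]; module)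
      obtain ⟨e1, e2, e3, e4⟩ := this
      subst e3
      exact ⟨e1, e2, by simpa using e4, rfl⟩
    have hδ : δ = 0 := Polynomial.funext (fun s => by rw [d1, hz]; simp)
    have := d2 0
    rw [hδ] at this
    simp only [zero_smul, add_zero, Polynomial.derivative_zero, Polynomial.eval_zero] at this
    exact h.simple hd va (by simpa using hz 0) this.symm
  obtain ⟨δ, dt, d1, d2⟩ := Dl_poly h a b e f
  have li_s : ∀ s : k, LinearIndependent k ![a, b, e + s • f, f] := by
    intro s
    rw [li4_iff] at hi ⊢
    intro x y z t hx
    have := hi x y z (z * s + t) (by rw [← hx]; module)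
    obtain ⟨e1, e2, e3, e4⟩ := this
    subst e3
    exact ⟨e1, e2, rfl, by simpa using e4⟩
  have li_s3 : ∀ s : k, LinearIndependent k ![a, b, e + s • f] := by
    intro s
    rw [li3_iff]
    intro x y z hx
    have := li4_iff.mp (li_s s) x y z 0 (by simpa using hx)
    tauto
  have δ0 : δ ≠ 0 := by
    intro h0
    apply hf
    rw [← dt.2, h0]; simp
  have hdeg : δ.natDegree = 5 := by
    apply le_antisymm dt.1
    apply Polynomial.le_natDegree_of_ne_zero
    rw [dt.2]; exact hf
  have hnodup : δ.roots.Nodup := by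
    rw [Multiset.nodup_iff_count_le_one]
    intro s
    rw [Polynomial.count_roots]
    by_contra hc
    push Not at hc
    obtain ⟨r1, r2⟩ := (Polynomial.one_lt_rootMultiplicity_iff_isRoot δ0).mp hc
    have r1' : δ.eval s = 0 := r1
    have r2' : δ.derivative.eval s = 0 := r2
    rw [d1] at r1'
    rw [d2] at r2'
    exact h.simple (li_s s) va r1' r2'
  have hcard : δ.roots.toFinset.card = 5 := by
    rw [Multiset.toFinset_card_of_nodup hnodup, ← hdeg]
    exact IsAlgClosed.card_roots_eq_natDegree
  let ev := δ.roots.toFinset.equivFinOfCardEq hcard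
  let σ : Fin 5 → k := fun i => (ev.symm i : k)
  have hσ : ∀ i, Dl T a b (e + σ i • f) = 0 := by
    intro i
    rw [← d1]
    have := (ev.symm i).2
    rw [Multiset.mem_toFinset, Polynomial.mem_roots δ0] at this
    exact this
  have hσi : Function.Injective σ := fun i j hij => ev.symm.injective (Subtype.ext hij)
  have hσs : ∀ s, Dl T a b (e + s • f) = 0 → ∃ i, σ i = s := by
    intro s hs
    rw [← d1] at hs
    have : s ∈ δ.roots.toFinset := by
      rw [Multiset.mem_toFinset, Polynomial.mem_roots δ0]; exact hs
    exact ⟨ev ⟨s, this⟩, by simp [σ]⟩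
  have hline := fun i => h.line_of_Dl (li_s3 (σ i)) va (hσ i)
  rw [← hlab] at hline
  choose m hm1 hm2 hm3 hm4 using hline
  have hthird := fun i => h.third hl (hm1 i) (hm2 i).symm (by rw [inf_comm]; exact hm3 i)
  choose m' hT using hthird
  have hH : ∀ i, l ⊔ m i = l ⊔ Submodule.span k {e + σ i • f} := by
    intro i
    apply Submodule.eq_of_le_of_finrank_eq (sup_le le_sup_left (hm4 i))
    rw [(hT i).rk, hlab, finrank_triple (li_s3 (σ i))]
  have hm4' : ∀ i, m' i ≤ l ⊔ Submodule.span k {e + σ i • f} := fun i => by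
    rw [← hH]; exact (hT i).le
  -- a line in two different planes is `l`
  have hdis : ∀ i j, i ≠ j → ∀ x, LN T x → x ≤ l ⊔ Submodule.span k {e + σ i • f} →
      x ≤ l ⊔ Submodule.span k {e + σ j • f} → x = l := by
    intro i j hij x hx h1 h2
    apply eq_of_le_line hx.1 hl.1
    intro v hv
    have v1 := h1 hv
    have v2 := h2 hv
    rw [hlab] at v1 v2
    obtain ⟨x1, y1, z1, e1⟩ := mem_sup_pair.mp v1
    obtain ⟨x2, y2, z2, e2⟩ := mem_sup_pair.mp v2
    have := li4_iff.mp hi (x1 - x2) (y1 - y2) (z1 - z2) (z1 * σ i - z2 * σ j) (by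
      rw [show (x1 - x2) • a + (y1 - y2) • b + (z1 - z2) • e + (z1 * σ i - z2 * σ j) • f =
        (x1 • a + y1 • b + z1 • (e + σ i • f)) - (x2 • a + y2 • b + z2 • (e + σ j • f)) by module,
        ← e1, ← e2, sub_self])
    obtain ⟨-, -, q3, q4⟩ := this
    have hz : z1 = z2 := by linear_combination q3
    subst hz
    have : z1 * (σ i - σ j) = 0 := by linear_combination q4
    rcases mul_eq_zero.mp this with h0 | h0
    · rw [hlab, Submodule.mem_span_pair]
      exact ⟨x1, y1, by rw [e1, h0]; simp⟩
    · exact absurd (hσi (sub_eq_zero.mp h0)) hij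
  refine ⟨m, m', hT, ?_, ?_⟩
  · intro i j hij
    refine ⟨?_, ?_, ?_⟩
    · intro he
      exact hm2 i (hdis i j hij _ (hm1 i) (hm4 i) (by rw [he]; exact hm4 j))
    · intro he
      exact hm2 i (hdis i j hij _ (hm1 i) (hm4 i) (by rw [he]; exact hm4' j))
    · intro he
      exact (hT i).nl (hdis i j hij _ (hT i).hn (hm4' i) (by rw [he]; exact hm4' j))
  · intro x hx hxl hmeet
    have : ¬ x ≤ l := fun hh => hxl (eq_of_le_line hx.1 hl.1 hh)
    obtain ⟨v, hvx, hvl⟩ := SetLike.not_le_iff_exists.mp this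
    obtain ⟨p, q, r, s, hv⟩ := span4 h.dim hi v
    have hrs : ∀ z t u : k, z • (r • e + s • f) = t • a + u • b → z = 0 := by
      intro z t u hz
      by_contra hz0
      apply hvl
      rw [hlab, Submodule.mem_span_pair]
      refine ⟨p + z⁻¹ * t, q + z⁻¹ * u, ?_⟩
      have : r • e + s • f = z⁻¹ • (t • a + u • b) := by
        rw [← hz, smul_smul, inv_mul_cancel₀ hz0, one_smul]
      rw [hv, add_assoc, this]; module
    have hi3 : LinearIndependent k ![a, b, r • e + s • f] := by
      rw [li3_iff]
      intro x y z hx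
      have hz := hrs z (-x) (-y) (by
        rw [show z • (r • e + s • f) = (x • a + y • b + z • (r • e + s • f)) +
          ((-x) • a + (-y) • b) by module, hx, zero_add])
      subst hz
      have := LinearIndependent.pair_iff.mp hab x y (by simpa using hx)
      tauto
    obtain ⟨P, hP, hP0⟩ := Submodule.exists_mem_ne_zero_of_ne_bot hmeet
    obtain ⟨hPx, hPl⟩ := Submodule.mem_inf.mp hP
    have hPv : LinearIndependent k ![P, v] := by
      rw [LinearIndependent.pair_iff' hP0]
      rintro c rfl
      exact hvl (l.smul_mem c hPl)
    have hxle : x ≤ l ⊔ Submodule.span k {r • e + s • f} := by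
      rw [eq_span_pair hx.1 hPx hvx hPv, Submodule.span_le]
      rintro u (rfl | rfl)
      · exact Submodule.mem_sup_left hPl
      · rw [hlab]
        exact mem_sup_pair.mpr ⟨p, q, 1, by rw [hv]; module⟩
    have hD : Dl T a b (r • e + s • f) = 0 :=
      h.Dl_of_line hi3 va hx (by rw [← hlab]; exact hxl) (by rw [← hlab]; exact hmeet)
        (by rw [← hlab]; exact hxle)
    have hr : r ≠ 0 := by
      rintro rfl
      rw [zero_smul, zero_add, Dl_smul] at hD
      have hs : s = 0 := by simpa [hf] using hD
      subst hs
      have := hrs 1 0 0 (by simp)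
      exact one_ne_zero this
    have hre : r • e + s • f = r • (e + (s / r) • f) := by
      rw [smul_add, smul_smul, mul_div_cancel₀ _ hr]
    rw [hre, Dl_smul] at hD
    obtain ⟨i, hii⟩ := hσs (s / r) (by simpa [hr] using hD)
    refine ⟨i, ?_⟩
    have := (hT i).side hx (by
      rw [hH, hii, ← Submodule.span_singleton_smul_eq (IsUnit.mk0 r hr), ← hre]; exact hxle)
    tauto

end Five

set_option linter.unusedSimpArgs false

section Exist
variable {k : Type} [Field k] {V : Type} [AddCommGroup V] [Module k V]
variable {T : V →ₗ[k] V →ₗ[k] V →ₗ[k] k}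

lemma Tp.congr {p : Polynomial k} {n m : ℕ} {c d : k} (h : Tp p n c) (h1 : n = m) (h2 : c = d) :
    Tp p m d := by subst h1; subst h2; exact h

/-- The resultant of the normal form has degree 27, hence a root. -/
lemma resultant_root [IsAlgClosed k] [CharZero k] (pun pwn pnn uun uwn unn wwn wnn nnn : k) :
    ∃ x g : k, g = x ^ 6 + 2 * pun * x ^ 4 + 2 * pwn * x ^ 3 + uun * x ^ 2 + 2 * uwn * x + wwn ∧
      ∃ y z : k, (y ≠ 0 ∨ z ≠ 0) ∧
      (- x) * y ^ 2 + 2 * (3 * x ^ 5 + 4 * pun * x ^ 3 + 3 * pwn * x ^ 2 + uun * x + uwn) * y * z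
        + (x ^ 3 * pnn + x * unn + wnn - 6 * g * (x ^ 3 + x * pun + pwn)) * z ^ 2 = 0 ∧
      (-1) * y ^ 3 + 3 * (9 * x ^ 4 + 6 * x ^ 2 * pun + uun) * y ^ 2 * z
        + 3 * (unn + 3 * x ^ 2 * pnn - 6 * g * (pun + 3 * x ^ 2)) * y * z ^ 2
        + (nnn - 9 * g * pnn + 27 * g ^ 2) * z ^ 3 = 0 := by
  have mono : ∀ (c : k) (n : ℕ), Tp (Polynomial.C c * Polynomial.X ^ n) n c := fun c n =>
    ((Tp.const c).mul (Tp.xpow n)).congr (by simp) (by simp)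
  obtain ⟨G, hG, eG⟩ : ∃ G : Polynomial k, Tp G 6 1 ∧ ∀ x, G.eval x =
      x ^ 6 + 2 * pun * x ^ 4 + 2 * pwn * x ^ 3 + uun * x ^ 2 + 2 * uwn * x + wwn :=
    ⟨_, ((mono 1 6).add (((mono (2 * pun) 4).lift (by norm_num)).add
      (((mono (2 * pwn) 3).lift (by norm_num)).add (((mono uun 2).lift (by norm_num)).add
      (((mono (2 * uwn) 1).lift (by norm_num)).add
        ((mono wwn 0).lift (by norm_num))))))).congr rfl (by simp), fun x => by simp; ring⟩
  obtain ⟨J, hJ, eJ⟩ : ∃ G : Polynomial k, Tp G 3 1 ∧ ∀ x, G.eval x = x ^ 3 + x * pun + pwn :=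
    ⟨_, ((mono 1 3).add (((mono pun 1).lift (by norm_num)).add
        ((mono pwn 0).lift (by norm_num)))).congr rfl (by simp), fun x => by simp; ring⟩
  obtain ⟨J2, hJ2, eJ2⟩ : ∃ G : Polynomial k, Tp G 2 3 ∧ ∀ x, G.eval x = pun + 3 * x ^ 2 :=
    ⟨_, ((mono 3 2).add ((mono pun 0).lift (by norm_num))).congr rfl (by simp),
      fun x => by simp; ring⟩
  obtain ⟨b0, hb0, eb0⟩ : ∃ G : Polynomial k, Tp G 1 (-1) ∧ ∀ x, G.eval x = - x :=
    ⟨_, mono (-1) 1, fun x => by simp⟩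
  obtain ⟨b1, hb1, eb1⟩ : ∃ G : Polynomial k, Tp G 5 6 ∧ ∀ x, G.eval x =
      2 * (3 * x ^ 5 + 4 * pun * x ^ 3 + 3 * pwn * x ^ 2 + uun * x + uwn) :=
    ⟨_, ((mono 6 5).add (((mono (8 * pun) 3).lift (by norm_num)).add
      (((mono (6 * pwn) 2).lift (by norm_num)).add (((mono (2 * uun) 1).lift (by norm_num)).add
        ((mono (2 * uwn) 0).lift (by norm_num)))))).congr rfl (by simp),
        fun x => by simp; ring⟩
  obtain ⟨b2, hb2, eb2⟩ : ∃ H : Polynomial k, Tp H 9 (-6) ∧ ∀ x, H.eval x =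
      x ^ 3 * pnn + x * unn + wnn - 6 * G.eval x * (x ^ 3 + x * pun + pwn) :=
    ⟨_, ((((Tp.const (-6)).mul hG).mul hJ).add (((mono pnn 3).lift (by norm_num)).add
      (((mono unn 1).lift (by norm_num)).add ((mono wnn 0).lift (by norm_num))))).congr
        (by norm_num) (by simp), fun x => by simp [eJ]; ring⟩
  obtain ⟨c1, hc1, ec1⟩ : ∃ G : Polynomial k, Tp G 4 27 ∧ ∀ x, G.eval x =
      3 * (9 * x ^ 4 + 6 * x ^ 2 * pun + uun) :=
    ⟨_, ((mono 27 4).add (((mono (18 * pun) 2).lift (by norm_num)).add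
        ((mono (3 * uun) 0).lift (by norm_num)))).congr rfl (by simp), fun x => by simp; ring⟩
  obtain ⟨c2, hc2, ec2⟩ : ∃ H : Polynomial k, Tp H 8 (-54) ∧ ∀ x, H.eval x =
      3 * (unn + 3 * x ^ 2 * pnn - 6 * G.eval x * (pun + 3 * x ^ 2)) :=
    ⟨_, ((((Tp.const (-18)).mul hG).mul hJ2).add (((mono (9 * pnn) 2).lift (by norm_num)).add
      ((mono (3 * unn) 0).lift (by norm_num)))).congr
        (by norm_num) (by norm_num), fun x => by simp [eJ2]; ring⟩
  obtain ⟨c3, hc3, ec3⟩ : ∃ H : Polynomial k, Tp H 12 27 ∧ ∀ x, H.eval x =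
      nnn - 9 * G.eval x * pnn + 27 * G.eval x ^ 2 :=
    ⟨_, (((Tp.const 27).mul (hG.pow 2)).add ((((Tp.const (-9 * pnn)).mul hG).lift
      (by norm_num)).add ((mono nnn 0).lift (by norm_num)))).congr
        (by norm_num) (by norm_num), fun x => by simp; ring⟩
  have hc0 := Tp.const (-1 : k)
  obtain ⟨c0, ec0⟩ : ∃ c0, c0 = Polynomial.C (-1 : k) := ⟨_, rfl⟩
  rw [← ec0] at hc0
  have h3 := Tp.const (3 : k)
  have h2 := Tp.const (2 : k)
  have t1 := (hb0.pow 3).mul (hc3.pow 2)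
  have t2 := (((hb0.pow 2).mul hb1).mul hc2).mul hc3
  have t3 := ((hb0.pow 2).mul hb2).mul ((hc2.pow 2).sub ((h2.mul hc1).mul hc3))
  have t4 := ((hb0.mul (hb1.pow 2)).mul hc1).mul hc3
  have t5 := ((hb0.mul hb1).mul hb2).mul (((h3.mul hc0).mul hc3).sub (hc1.mul hc2))
  have t6 := (hb0.mul (hb2.pow 2)).mul ((hc1.pow 2).sub ((h2.mul hc0).mul hc2))
  have t7 := ((hb1.pow 3).mul hc0).mul hc3
  have t8 := (((hb1.pow 2).mul hb2).mul hc0).mul hc2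
  have t9 := ((hb1.mul (hb2.pow 2)).mul hc0).mul hc1
  have t10 := (hb2.pow 3).mul (hc0.pow 2)
  norm_num at t1 t2 t3 t4 t5 t6 t7 t8 t9 t10
  have t := ((((((((t1.sub t2).add t3).add t4).add t5).add t6).sub t7).add t8).sub t9).add t10
  norm_num at t
  have root : ∀ Q : Polynomial k, Tp Q 27 27 → ∃ x, Q.IsRoot x := fun Q t =>
    IsAlgClosed.exists_root Q (fun h0 => by
    have h1 := Polynomial.natDegree_eq_of_degree_eq_some h0
    have h2 := Polynomial.coeff_eq_zero_of_natDegree_lt (lt_of_eq_of_lt h1 (by norm_num : 0 < 27))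
    rw [t.2] at h2
    norm_num at h2)
  obtain ⟨x, hx⟩ := root _ t
  refine ⟨x, G.eval x, eG x, ?_⟩
  rw [← eb0, ← eb1, ← eb2, ← ec1, ← ec2, ← ec3]
  apply resultant_zero
  have := hx
  simp only [Polynomial.IsRoot, Polynomial.eval_add, Polynomial.eval_sub, Polynomial.eval_mul,
    Polynomial.eval_pow, Polynomial.eval_ofNat, Polynomial.eval_C, ec0] at this
  linear_combination this

lemma SC.exists_line_normal [IsAlgClosed k] [CharZero k] (h : SC T) {p u w n : V}
    (hi : LinearIndependent k ![p, u, w, n])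
    (ppp : T p p p = 0) (ppu : T p p u = 0) (ppw : T p p w = 0) (ppn : T p p n = 1)
    (puu : T p u u = 0) (puw : T p u w = 0) (pww : T p w w = 1 / 3)
    (uuu : T u u u = -1) (uuw : T u u w = 0) (uww : T u w w = 0) (www : T w w w = 0) :
    ∃ W, LN T W := by
  obtain ⟨x, g, hg, y, z, hyz, e1, e2⟩ := resultant_root (T p u n) (T p w n) (T p n n) (T u u n)
    (T u w n) (T u n n) (T w w n) (T w n n) (T n n n)
  obtain ⟨R, hR⟩ : ∃ R, R = x ^ 3 • p + x • u + w := ⟨_, rfl⟩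
  obtain ⟨U, hU⟩ : ∃ U, U = u + (3 * x ^ 2) • p := ⟨_, rfl⟩
  obtain ⟨N, hN⟩ : ∃ N, N = n - (3 * g) • p := ⟨_, rfl⟩
  have s2 : ∀ a b c, T a b c = T a c b := h.s2
  have ss := fun a b : V => h.s1 a b
  have RRR : T R R R = 0 := by
    rw [hR]
    simp only [map_add, map_sub, map_smul, LinearMap.add_apply, LinearMap.sub_apply,
      LinearMap.smul_apply, smul_eq_mul, ss u p, ss w p, ss n p, ss w u, ss n u, ss n w,
      fun a => s2 a u p, fun a => s2 a w p, fun a => s2 a n p, fun a => s2 a w u,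
      fun a => s2 a n u, fun a => s2 a n w, ppp, ppu, ppw, ppn, puu, puw, pww, uuu, uuw, uww, www]
    field_simp
    ring
  have RRU : T R R U = 0 := by
    rw [hR, hU]
    simp only [map_add, map_sub, map_smul, LinearMap.add_apply, LinearMap.sub_apply,
      LinearMap.smul_apply, smul_eq_mul, ss u p, ss w p, ss n p, ss w u, ss n u, ss n w,
      fun a => s2 a u p, fun a => s2 a w p, fun a => s2 a n p, fun a => s2 a w u,
      fun a => s2 a n u, fun a => s2 a n w, ppp, ppu, ppw, ppn, puu, puw, pww, uuu, uuw, uww, www]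
    field_simp
    ring
  have RRN : T R R N = 0 := by
    rw [hR, hN, hg]
    simp only [map_add, map_sub, map_smul, LinearMap.add_apply, LinearMap.sub_apply,
      LinearMap.smul_apply, smul_eq_mul, ss u p, ss w p, ss n p, ss w u, ss n u, ss n w,
      fun a => s2 a u p, fun a => s2 a w p, fun a => s2 a n p, fun a => s2 a w u,
      fun a => s2 a n u, fun a => s2 a n w, ppp, ppu, ppw, ppn, puu, puw, pww, uuu, uuw, uww, www]
    field_simp
    ring
  have RQQ : T R (y • U + z • N) (y • U + z • N) = 0 := by
    rw [← e1, hR, hU, hN]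
    simp only [map_add, map_sub, map_smul, LinearMap.add_apply, LinearMap.sub_apply,
      LinearMap.smul_apply, smul_eq_mul, ss u p, ss w p, ss n p, ss w u, ss n u, ss n w,
      fun a => s2 a u p, fun a => s2 a w p, fun a => s2 a n p, fun a => s2 a w u,
      fun a => s2 a n u, fun a => s2 a n w, ppp, ppu, ppw, ppn, puu, puw, pww, uuu, uuw, uww, www]
    ring
  have QQQ : T (y • U + z • N) (y • U + z • N) (y • U + z • N) = 0 := by
    rw [← e2, hU, hN]
    simp only [map_add, map_sub, map_smul, LinearMap.add_apply, LinearMap.sub_apply,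
      LinearMap.smul_apply, smul_eq_mul, ss u p, ss w p, ss n p, ss w u, ss n u, ss n w,
      fun a => s2 a u p, fun a => s2 a w p, fun a => s2 a n p, fun a => s2 a w u,
      fun a => s2 a n u, fun a => s2 a n w, ppp, ppu, ppw, ppn, puu, puw, pww, uuu, uuw, uww, www]
    ring
  refine ⟨_, LN_of_pair h (a := R) (b := y • U + z • N) ?_ RRR ?_ RQQ QQQ⟩
  · rw [LinearIndependent.pair_iff]
    intro s t hst
    have := li4_iff.mp hi (s * x ^ 3 + t * (y * (3 * x ^ 2) - z * (3 * g))) (s * x + t * y) s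
      (t * z) (by rw [← hst, hR, hU, hN]; module)
    obtain ⟨-, q2, q3, q4⟩ := this
    subst q3
    refine ⟨rfl, ?_⟩
    rcases hyz with h0 | h0
    · simpa [h0] using q2
    · simpa [h0] using q4
  · rw [map_add, map_smul, map_smul, RRU, RRN]; simp

/-- A line through a parabolic point configuration. -/
lemma SC.exists_line_of_singular [IsAlgClosed k] [CharZero k] (h : SC T) {p u : V} (hp : p ≠ 0)
    (hu : u ≠ 0) (ppp : T p p p = 0) (pu : ∀ v, T p u v = 0) : ∃ W, LN T W := by
  have s2 : ∀ a b c, T a b c = T a c b := h.s2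
  have ss := fun a b : V => h.s1 a b
  have ppu : T p p u = 0 := by rw [s2]; exact pu p
  have hpu : LinearIndependent k ![p, u] := by
    rw [LinearIndependent.pair_iff' hp]
    rintro c rfl
    have hc : c ≠ 0 := by rintro rfl; simp at hu
    apply hp
    apply h.sm
    intro v
    have := pu v
    simpa [hc] using this
  obtain ⟨w, n, hi, ppw, ppn⟩ : ∃ w n, LinearIndependent k ![p, u, w, n] ∧ T p p w = 0 ∧
      T p p n = 1 := by
    obtain ⟨c, hc⟩ := extend2 h.dim hpu
    obtain ⟨d, hd⟩ := extend3 h.dim hc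
    by_cases h0 : T p p d = 0
    · have h1 : T p p c ≠ 0 := by
        intro h1
        apply hp
        apply h.sm
        intro v
        obtain ⟨x, y, z, t, rfl⟩ := span4 h.dim hd v
        simp [ppp, ppu, h0, h1]
      refine ⟨d, (T p p c)⁻¹ • c, ?_, h0, by simp [h1]⟩
      rw [li4_iff] at hd ⊢
      intro x y z t hx
      have := hd x y (t * (T p p c)⁻¹) z (by rw [← hx]; module)
      simp [h1] at this
      tauto
    · refine ⟨c - (T p p c / T p p d) • d, (T p p d)⁻¹ • d, ?_, by simp [h0], by simp [h0]⟩
      rw [li4_iff] at hd ⊢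
      intro x y z t hx
      obtain ⟨q1, q2, q3, q4⟩ := hd x y z (t * (T p p d)⁻¹ - z * (T p p c / T p p d))
        (by rw [← hx]; module)
      subst q3
      simp [h0] at q4
      tauto
  by_cases pww : T p w w = 0
  · obtain ⟨y, x, hyx, hz⟩ := binary_cubic_zero (T u u u) (3 * T u u w) (3 * T u w w) (T w w w)
    refine ⟨_, LN_of_pair h (a := p) (b := y • u + x • w) ?_ ppp ?_ ?_ ?_⟩
    · rw [LinearIndependent.pair_iff]
      intro s t hst
      obtain ⟨q1, q2, q3, -⟩ := li4_iff.mp hi s (t * y) (t * x) 0 (by rw [← hst]; module)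
      refine ⟨q1, ?_⟩
      rcases hyx with h0 | h0
      · simpa [h0] using q2
      · simpa [h0] using q3
    · simp [ppu, ppw]
    · simp [pu, s2 p w u, pww]
    · rw [← hz]
      simp only [map_add, map_smul, LinearMap.add_apply, LinearMap.smul_apply, smul_eq_mul,
        ss w u, fun a => s2 a w u]
      ring
  by_cases uuu : T u u u = 0
  · exact ⟨_, LN_of_pair h hpu ppp ppu (pu u) uuu⟩
  obtain ⟨c, hc⟩ : ∃ c, T u u w = c * T u u u := ⟨T u u w / T u u u, by field_simp⟩
  obtain ⟨e, he⟩ : ∃ e, e * T p w w = - (T u w w - c ^ 2 * T u u u) :=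
    ⟨- (T u w w - c ^ 2 * T u u u) / T p w w, by field_simp⟩
  obtain ⟨d, hd⟩ : ∃ d, 3 * d * T p w w = - (T w w w - 3 * c * T u w w + 2 * c ^ 3 * T u u u) :=
    ⟨- (T w w w - 3 * c * T u w w + 2 * c ^ 3 * T u u u) / (3 * T p w w), by field_simp⟩
  obtain ⟨s, hs⟩ : ∃ s, s * T p w w = 1 / 3 := ⟨1 / 3 / T p w w, by field_simp⟩
  obtain ⟨t, ht⟩ : ∃ t : k, t ^ 3 = - 1 / T u u u := IsAlgClosed.exists_pow_nat_eq _ (by norm_num)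
  have ht' : t ^ 3 * T u u u = -1 := by rw [ht]; field_simp
  have s0 : s ≠ 0 := by rintro rfl; norm_num at hs
  have t0 : t ≠ 0 := by rintro rfl; norm_num at ht'
  apply h.exists_line_normal (p := s • p) (u := t • (u + e • p)) (w := w - c • u + d • p)
    (n := (s⁻¹ ^ 2) • n)
  · rw [li4_iff] at hi ⊢
    intro x y z r hx
    obtain ⟨q1, q2, q3, q4⟩ := hi (x * s + y * t * e + z * d) (y * t - z * c) z (r * s⁻¹ ^ 2)
      (by rw [← hx]; module)
    subst q3
    have hy : y = 0 := by simpa [t0] using q2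
    subst hy
    simp [s0] at q1 q4
    tauto
  all_goals
    simp only [map_add, map_sub, map_smul, LinearMap.add_apply, LinearMap.sub_apply,
      LinearMap.smul_apply, smul_eq_mul, ss u p, ss w p, ss w u,
      fun a => s2 a u p, fun a => s2 a w p, fun a => s2 a w u, ppp, ppu, ppw, ppn, pu]
  any_goals ring1
  · field_simp
  · linear_combination hs
  · linear_combination ht'
  · linear_combination t ^ 2 * hc
  · linear_combination t * he - 2 * c * t * hc
  · linear_combination hd + 3 * c ^ 2 * hc

end Exist

section Hess
variable {k : Type} [Field k]

lemma pderiv_swap (i j : Fin 4) (f : MvPolynomial (Fin 4) k) :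
    pderiv i (pderiv j f) = pderiv j (pderiv i f) := by
  have h : ⁅(pderiv i : Derivation k (MvPolynomial (Fin 4) k) (MvPolynomial (Fin 4) k)),
      (pderiv j : Derivation k (MvPolynomial (Fin 4) k) (MvPolynomial (Fin 4) k))⁆ = 0 := by
    apply MvPolynomial.derivation_ext
    intro l
    rw [Derivation.commutator_apply]
    simp only [pderiv_X, Pi.single_apply]
    split_ifs <;> simp
  have := congrArg (fun D => D f) h
  simp only [Derivation.commutator_apply, Derivation.zero_apply] at this
  exact sub_eq_zero.mp this

/-- Two polynomials in four variables vanishing at the origin have another common zero. -/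
lemma two_polys [IsAlgClosed k] (f g : MvPolynomial (Fin 4) k) (hf : eval 0 f = 0)
    (hg : eval 0 g = 0) : ∃ p : Fin 4 → k, p ≠ 0 ∧ eval p f = 0 ∧ eval p g = 0 := by
  classical
  by_contra hcon
  push Not at hcon
  let I : Ideal (MvPolynomial (Fin 4) k) := Ideal.span (({f, g} : Finset _) : Set _)
  have hz : zeroLocus k I = {0} := by
    rw [zeroLocus_span]
    ext x
    simp only [Finset.coe_pair, Set.mem_insert_iff, Set.mem_singleton_iff, forall_eq_or_imp,
      forall_eq, Set.mem_ofPred_eq, aeval_eq_eval]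
    constructor
    · rintro ⟨h1, h2⟩
      by_contra h0
      exact hcon x h0 h1 h2
    · rintro rfl
      exact ⟨hf, hg⟩
  let φ : ℕ → MvPolynomial (Fin 4) k →ₐ[k] MvPolynomial (Fin 4) k := fun n =>
    aeval (fun i => if (i : ℕ) < n then 0 else X i)
  have hφ : ∀ n (i : Fin 4), φ n (X i) = if (i : ℕ) < n then 0 else X i := fun n i => by simp [φ]
  let P : ℕ → Ideal (MvPolynomial (Fin 4) k) := fun n => RingHom.ker (φ n)
  have hP : ∀ n, (P n).IsPrime := fun n => RingHom.ker_isPrime _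
  have hle : ∀ n, P n ≤ P (n + 1) := by
    intro n q hq
    have hc : φ (n + 1) = (φ (n + 1)).comp (φ n) := by
      apply MvPolynomial.algHom_ext
      intro i
      rw [AlgHom.comp_apply, hφ, hφ]
      split_ifs with h1 h2 h2
      · simp
      · rw [hφ, if_pos h1]
      · omega
      · rw [hφ, if_neg h1]
    have hq' : φ n q = 0 := hq
    change φ (n + 1) q = 0
    rw [hc, AlgHom.comp_apply, hq', map_zero]
  have hlt : ∀ n : Fin 4, P n < P (n + 1) := by
    intro n
    refine lt_of_le_of_ne (hle n) (fun he => ?_)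
    have h1 : (X n : MvPolynomial (Fin 4) k) ∈ P (n + 1) := by
      change φ _ _ = 0
      rw [hφ, if_pos (by omega)]
    rw [← he] at h1
    change φ _ _ = 0 at h1
    rw [hφ, if_neg (by omega)] at h1
    exact X_ne_zero n h1
  have h4 : P 4 = vanishingIdeal k ({0} : Set (Fin 4 → k)) := by
    ext q
    rw [mem_vanishingIdeal_singleton_iff]
    have hc : φ 4 = (Algebra.ofId k _).comp (aeval (0 : Fin 4 → k)) := by
      apply MvPolynomial.algHom_ext
      intro i
      rw [AlgHom.comp_apply, hφ, if_pos i.2, aeval_X]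
      simp
    change φ 4 q = 0 ↔ _
    rw [hc, AlgHom.comp_apply, Algebra.ofId_apply, algebraMap_eq]
    simp
  have hmin : P 4 ∈ I.minimalPrimes := by
    have hr : I.radical = P 4 := by
      rw [h4, ← hz, vanishingIdeal_zeroLocus_eq_radical]
    refine ⟨⟨hP 4, ?_⟩, ?_⟩
    · rw [← hr]; exact Ideal.le_radical
    · rintro Q ⟨hQ, hIQ⟩ -
      rw [← hr]
      exact (Ideal.IsPrime.radical_le_iff hQ).mpr hIQ
  have hh := Ideal.height_le_card_of_mem_minimalPrimes_span_finset hmin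
  have hc : (({f, g} : Finset (MvPolynomial (Fin 4) k)).card : ℕ∞) ≤ 2 := by
    exact_mod_cast Finset.card_le_two
  have := hP
  have l3 := Ideal.height_strict_mono_of_isPrime_of_isPrime (hlt 3)
  have l2 := Ideal.height_strict_mono_of_isPrime_of_isPrime (hlt 2)
  have l1 := Ideal.height_strict_mono_of_isPrime_of_isPrime (hlt 1)
  change (P 3).height < (P 4).height at l3
  change (P 2).height < (P 3).height at l2
  change (P 1).height < (P 2).height at l1
  have a1 := Order.add_one_le_of_lt l1
  have a2 := Order.add_one_le_of_lt l2
  have a3 := Order.add_one_le_of_lt l3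
  have : (1 + 1 + 1 : ℕ∞) ≤ 2 := by
    calc (1 + 1 + 1 : ℕ∞) ≤ ((P 1).height + 1) + 1 + 1 := by gcongr; simp
      _ ≤ (P 2).height + 1 + 1 := by gcongr
      _ ≤ (P 3).height + 1 := by gcongr
      _ ≤ (P 4).height := a3
      _ ≤ 2 := hh.trans hc
  exact absurd this (by decide)

/-- The third derivatives. -/
noncomputable def qd (F : MvPolynomial (Fin 4) k) (i j l : Fin 4) : k :=
  eval 0 (pderiv l (pderiv j (pderiv i F)))

/-- The symmetric trilinear form of a cubic form. -/
noncomputable def TF (F : MvPolynomial (Fin 4) k) :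
    (Fin 4 → k) →ₗ[k] (Fin 4 → k) →ₗ[k] (Fin 4 → k) →ₗ[k] k :=
  ∑ l, ∑ j, ∑ i, (qd F i j l / 6) • (LinearMap.proj (R := k) (φ := fun _ : Fin 4 => k) l).smulRight
    ((LinearMap.proj (R := k) (φ := fun _ : Fin 4 => k) j).smulRight
      (LinearMap.proj (R := k) (φ := fun _ : Fin 4 => k) i))

lemma TF_apply (F : MvPolynomial (Fin 4) k) (u v w : Fin 4 → k) :
    TF F u v w = ∑ l, ∑ j, ∑ i, qd F i j l / 6 * (u l * (v j * w i)) := by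
  simp [TF, LinearMap.sum_apply]

lemma qd_symm1 (F : MvPolynomial (Fin 4) k) (i j l : Fin 4) : qd F i j l = qd F j i l := by
  unfold qd; rw [pderiv_swap j i]

lemma qd_symm2 (F : MvPolynomial (Fin 4) k) (i j l : Fin 4) : qd F i j l = qd F i l j := by
  unfold qd; rw [pderiv_swap l j]

lemma euler_eval {f : MvPolynomial (Fin 4) k} {n : ℕ} (h : f.IsHomogeneous n) (v : Fin 4 → k) :
    ∑ i, v i * eval v (pderiv i f) = n * eval v f := by
  have := congrArg (eval v) h.sum_X_mul_pderiv
  simpa [map_sum] using this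

lemma hess_eval {F : MvPolynomial (Fin 4) k} (hF : F.IsHomogeneous 3) (v : Fin 4 → k)
    (i j : Fin 4) : eval v (pderiv j (pderiv i F)) = ∑ l, v l * qd F i j l := by
  have h1 : (pderiv j (pderiv i F)).IsHomogeneous 1 := hF.pderiv.pderiv
  rw [← one_mul (eval v _), ← Nat.cast_one, ← euler_eval h1]
  refine Finset.sum_congr rfl fun l _ => ?_
  have h0 : (pderiv l (pderiv j (pderiv i F))).IsHomogeneous 0 := h1.pderiv
  rw [← totalDegree_zero_iff_isHomogeneous, totalDegree_eq_zero_iff_eq_C] at h0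
  unfold qd
  rw [h0]; simp

lemma TF_hess [CharZero k] {F : MvPolynomial (Fin 4) k} (hF : F.IsHomogeneous 3)
    (v u w : Fin 4 → k) :
    6 * TF F v u w = ∑ i, w i * ∑ j, u j * eval v (pderiv j (pderiv i F)) := by
  simp only [hess_eval hF, TF_apply, Finset.mul_sum]
  rw [Finset.sum_comm' (t' := Finset.univ) (s' := fun _ => Finset.univ) (by simp)]
  rw [Finset.sum_congr rfl fun j _ => Finset.sum_comm]
  rw [Finset.sum_comm]
  refine Finset.sum_congr rfl fun i _ => Finset.sum_congr rfl fun j _ =>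
    Finset.sum_congr rfl fun l _ => ?_
  field_simp

lemma TF_grad [CharZero k] {F : MvPolynomial (Fin 4) k} (hF : F.IsHomogeneous 3)
    (v w : Fin 4 → k) : 3 * TF F v v w = ∑ i, w i * eval v (pderiv i F) := by
  have h := TF_hess hF v v w
  have : ∀ i, ∑ j, v j * eval v (pderiv j (pderiv i F)) = 2 * eval v (pderiv i F) := fun i => by
    have h2 : (pderiv i F).IsHomogeneous 2 := hF.pderiv
    rw [euler_eval h2]; norm_num
  simp only [this] at h
  have h' : 2 * (3 * TF F v v w) = 2 * ∑ i, w i * eval v (pderiv i F) := by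
    rw [Finset.mul_sum, show 2 * (3 * TF F v v w) = 6 * TF F v v w by ring, h]
    exact Finset.sum_congr rfl fun i _ => by ring
  exact mul_left_cancel₀ two_ne_zero h'

lemma TF_self [CharZero k] {F : MvPolynomial (Fin 4) k} (hF : F.IsHomogeneous 3)
    (v : Fin 4 → k) : TF F v v v = eval v F := by
  have h := TF_grad hF v v
  rw [euler_eval hF] at h
  exact mul_left_cancel₀ three_ne_zero (by simpa using h)

lemma TF_SC [CharZero k] {F : MvPolynomial (Fin 4) k} (hF : F.IsHomogeneous 3)
    (hsmooth : ∀ v : Fin 4 → k, (∀ i : Fin 4, eval v (pderiv i F) = 0) → v = 0) :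
    SC (TF F) where
  s1 u v w := by
    simp only [TF_apply]
    rw [Finset.sum_comm]
    refine Finset.sum_congr rfl fun j _ => Finset.sum_congr rfl fun l _ =>
      Finset.sum_congr rfl fun i _ => ?_
    rw [qd_symm2]; ring
  s2 u v w := by
    simp only [TF_apply]
    refine Finset.sum_congr rfl fun l _ => ?_
    rw [Finset.sum_comm]
    refine Finset.sum_congr rfl fun j _ => Finset.sum_congr rfl fun i _ => ?_
    rw [qd_symm1]; ring
  sm v hv := by
    apply hsmooth
    intro i
    have := TF_grad hF v (Pi.single i 1)
    rw [hv] at this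
    simpa [Pi.single_apply] using this.symm
  dim := by simp

lemma TF_exists_line [IsAlgClosed k] [CharZero k] {F : MvPolynomial (Fin 4) k}
    (hF : F.IsHomogeneous 3)
    (hsmooth : ∀ v : Fin 4 → k, (∀ i : Fin 4, eval v (pderiv i F) = 0) → v = 0) :
    ∃ W, LN (TF F) W := by
  let M : Matrix (Fin 4) (Fin 4) (MvPolynomial (Fin 4) k) :=
    Matrix.of fun i j => pderiv j (pderiv i F)
  have hM : ∀ v : Fin 4 → k, eval v M.det =
      (Matrix.of fun i j => eval v (pderiv j (pderiv i F))).det := by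
    intro v
    rw [RingHom.map_det]
    congr 1
  obtain ⟨p, hp, h1, h2⟩ := two_polys F M.det (by
    rw [← TF_self hF]; simp) (by
    rw [hM]
    have : (Matrix.of fun i j => eval 0 (pderiv j (pderiv i F))) =
      (0 : Matrix (Fin 4) (Fin 4) k) := by
      ext i j
      rw [Matrix.of_apply, hess_eval hF]
      simp
    rw [this]; simp)
  rw [hM] at h2
  obtain ⟨u, hu, hMu⟩ := Matrix.exists_mulVec_eq_zero_iff.mpr h2
  refine (TF_SC hF hsmooth).exists_line_of_singular hp hu (by rw [TF_self hF]; exact h1) ?_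
  intro w
  have h := TF_hess hF p u w
  have : ∀ i, ∑ j, u j * eval p (pderiv j (pderiv i F)) = 0 := fun i => by
    have := congrFun hMu i
    simp only [Matrix.mulVec, dotProduct, Matrix.of_apply, Pi.zero_apply] at this
    rw [← this]
    exact Finset.sum_congr rfl fun j _ => mul_comm _ _
  simp only [this] at h
  simpa using h

end Hess

section Comb
variable {L : Type}

/-- The incidence properties of the lines on a cubic surface. -/
structure GQ (A : L → L → Prop) : Prop where
  symm : ∀ x y, A x y → A y x
  irr : ∀ x, ¬ A x x
  third : ∃ t : L → L → L, ∀ x y, A x y → A x (t x y) ∧ A y (t x y) ∧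
    (∀ p, A p x → A p y → p = t x y) ∧
    ∀ p, p = x ∨ p = y ∨ p = t x y ∨ A p x ∨ A p y ∨ A p (t x y)
  deg : ∀ l, ∃ e : Fin 5 ⊕ Fin 5 → L, Function.Injective e ∧ ∀ x, A l x ↔ ∃ i, e i = x

/-- Abstract double sixes. -/
structure DS (A : L → L → Prop) (a b : Fin 6 → L) : Prop where
  aa : ∀ i j, i ≠ j → a i ≠ a j ∧ ¬ A (a i) (a j)
  bb : ∀ i j, i ≠ j → b i ≠ b j ∧ ¬ A (b i) (b j)
  ab : ∀ i, a i ≠ b i ∧ ¬ A (a i) (b i)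
  mt : ∀ i j, i ≠ j → A (a i) (b j)

/-- The candidate double six through a pair of disjoint lines. -/
def DD (A : L → L → Prop) (p q : L) : Set L :=
  {x | x = p ∨ x = q ∨ (A p x ∧ ¬ A q x) ∨ (A q x ∧ ¬ A p x)}

variable {A : L → L → Prop}

lemma GQ.finite (h : GQ A) [Nonempty L] : Finite L := by
  obtain ⟨l⟩ := ‹Nonempty L›
  obtain ⟨t, ht⟩ := h.third
  obtain ⟨e, -, he⟩ := h.deg l
  have hx : A l (e (Sum.inl 0)) := (he _).mpr ⟨_, rfl⟩
  obtain ⟨x, hx'⟩ : ∃ x, x = e (Sum.inl 0) := ⟨_, rfl⟩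
  rw [← hx'] at hx
  obtain ⟨h1, h2, -, h4⟩ := ht l x hx
  have fin : ∀ y, {z | A y z}.Finite := by
    intro y
    obtain ⟨e, -, he⟩ := h.deg y
    have : {z | A y z} = Set.range e := by ext z; exact he z
    rw [this]; exact Set.finite_range e
  rw [← Set.finite_univ_iff]
  refine ((fin l).union ((fin x).union (fin (t l x)))).subset ?_
  intro p _
  simp only [Set.mem_union, Set.mem_ofPred_eq]
  rcases h4 p with rfl | rfl | rfl | h5 | h5 | h5
  · exact Or.inr (Or.inl (h.symm _ _ hx))
  · exact Or.inl hx
  · exact Or.inl h1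
  · exact Or.inl (h.symm _ _ h5)
  · exact Or.inr (Or.inl (h.symm _ _ h5))
  · exact Or.inr (Or.inr (h.symm _ _ h5))

open Classical in
lemma GQ.cardN [Fintype L] (h : GQ A) (l : L) : (Finset.univ.filter (A l)).card = 10 := by
  obtain ⟨e, hi, he⟩ := h.deg l
  have : Finset.univ.filter (A l) = Finset.univ.image e := by
    ext z; simp [he z]
  rw [this, Finset.card_image_of_injective _ hi]
  simp

open Classical in
lemma GQ.card [Fintype L] [Nonempty L] (h : GQ A) : Fintype.card L = 27 := by
  obtain ⟨l⟩ := ‹Nonempty L›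
  obtain ⟨t, ht⟩ := h.third
  obtain ⟨e, -, he⟩ := h.deg l
  have hx : A l (e (Sum.inl 0)) := (he _).mpr ⟨_, rfl⟩
  obtain ⟨x, hx'⟩ : ∃ x, x = e (Sum.inl 0) := ⟨_, rfl⟩
  rw [← hx'] at hx
  obtain ⟨h1, h2, h3, h4⟩ := ht l x hx
  obtain ⟨z, hz⟩ : ∃ z, z = t l x := ⟨_, rfl⟩
  rw [← hz] at h1 h2 h3 h4
  obtain ⟨-, -, k3, -⟩ := ht l z h1
  obtain ⟨-, -, m3, -⟩ := ht x z h2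
  have ex := k3 x (h.symm _ _ hx) h2
  have el := m3 l hx h1
  rw [← ex] at k3
  rw [← el] at m3
  have i1 : Finset.univ.filter (A l) ∩ Finset.univ.filter (A x) = {z} := by
    ext y
    simp only [Finset.mem_inter, Finset.mem_filter, Finset.mem_univ, true_and,
      Finset.mem_singleton]
    exact ⟨fun ⟨a, b⟩ => h3 y (h.symm _ _ a) (h.symm _ _ b), fun hy => hy ▸ ⟨h1, h2⟩⟩
  have i2 : (Finset.univ.filter (A l) ∪ Finset.univ.filter (A x)) ∩ Finset.univ.filter (A z)
      = {x, l} := by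
    ext y
    simp only [Finset.mem_inter, Finset.mem_union, Finset.mem_filter, Finset.mem_univ, true_and,
      Finset.mem_singleton, Finset.mem_insert]
    constructor
    · rintro ⟨a | a, b⟩
      · exact Or.inl (k3 y (h.symm _ _ a) (h.symm _ _ b))
      · exact Or.inr (m3 y (h.symm _ _ a) (h.symm _ _ b))
    · rintro (rfl | rfl)
      · exact ⟨Or.inl hx, h.symm _ _ h2⟩
      · exact ⟨Or.inr (h.symm _ _ hx), h.symm _ _ h1⟩
  have u : (Finset.univ.filter (A l) ∪ Finset.univ.filter (A x)) ∪ Finset.univ.filter (A z)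
      = Finset.univ := by
    ext p
    simp only [Finset.mem_union, Finset.mem_filter, Finset.mem_univ, true_and, iff_true]
    rcases h4 p with rfl | rfl | rfl | h5 | h5 | h5
    · exact Or.inl (Or.inr (h.symm _ _ hx))
    · exact Or.inl (Or.inl hx)
    · exact Or.inl (Or.inl h1)
    · exact Or.inl (Or.inl (h.symm _ _ h5))
    · exact Or.inl (Or.inr (h.symm _ _ h5))
    · exact Or.inr (h.symm _ _ h5)
  have c1 := Finset.card_union_add_card_inter (Finset.univ.filter (A l)) (Finset.univ.filter (A x))
  have c2 := Finset.card_union_add_card_inter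
    (Finset.univ.filter (A l) ∪ Finset.univ.filter (A x)) (Finset.univ.filter (A z))
  have hne : x ≠ l := by rintro rfl; exact h.irr _ hx
  rw [i1, h.cardN, h.cardN, Finset.card_singleton] at c1
  rw [i2, u, h.cardN, Finset.card_pair hne, Finset.card_univ] at c2
  omega

/-- Five common neighbours of a disjoint pair, and the resulting double six. -/
lemma GQ.build (h : GQ A) {p q : L} (hpq : p ≠ q) (hn : ¬ A p q) :
    ∃ a b : Fin 6 → L, DS A a b ∧ a 0 = p ∧ b 0 = q ∧
      Set.range a ∪ Set.range b = DD A p q := by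
  classical
  obtain ⟨l⟩ : Nonempty L := ⟨p⟩
  obtain ⟨t, ht⟩ := h.third
  -- adjacency to exactly one of `x` and `t r x`
  have key : ∀ r s : L, r ≠ s → ¬ A r s → ∀ x, A r x →
      (A s x ∧ ¬ A s (t r x)) ∨ (¬ A s x ∧ A s (t r x)) := by
    intro r s hrs hns x hx
    obtain ⟨h1, h2, h3, h4⟩ := ht r x hx
    rcases h4 s with h5 | h5 | h5 | h5 | h5 | h5
    · exact absurd h5.symm hrs
    · exact absurd (h5 ▸ hx) hns
    · exact absurd (h5 ▸ h1) hns
    · exact absurd (h.symm _ _ h5) hns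
    · refine Or.inl ⟨h5, fun h6 => hns ?_⟩
      obtain ⟨-, -, m3, -⟩ := ht x _ h2
      rw [m3 s h5 h6, ← m3 r hx h1] at hns
      rw [m3 r hx h1, ← m3 s h5 h6] at hrs
      exact absurd rfl hrs
    · refine Or.inr ⟨fun h6 => hns ?_, h5⟩
      obtain ⟨-, -, m3, -⟩ := ht x _ h2
      rw [m3 r hx h1, ← m3 s h6 h5] at hrs
      exact absurd rfl hrs
  -- two adjacent neighbours of `r` are partners
  have uniq : ∀ r x y : L, A r x → A r y → A x y → y = t r x := fun r x y h1 h2 h3 =>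
    (ht r x h1).2.2.1 y (h.symm _ _ h2) (h.symm _ _ h3)
  have inv : ∀ r x : L, A r x → t r (t r x) = x := by
    intro r x hx
    obtain ⟨h1, h2, -, -⟩ := ht r x hx
    exact (uniq r (t r x) x h1 hx (h.symm _ _ h2)).symm
  have hnq : ¬ A q p := fun h0 => hn (h.symm _ _ h0)
  -- the set of common neighbours
  obtain ⟨e, ei, he⟩ := h.deg p
  let N : Finset L := Finset.univ.image e
  have memN : ∀ x, x ∈ N ↔ A p x := fun x => by rw [he]; simp [N]
  have cN : N.card = 10 := by
    rw [Finset.card_image_of_injective _ ei]; simp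
  let C := N.filter (A q)
  let C' := N.filter (fun x => ¬ A q x)
  have memC : ∀ x, x ∈ C ↔ A p x ∧ A q x := fun x => by simp [C, memN]
  have memC' : ∀ x, x ∈ C' ↔ A p x ∧ ¬ A q x := fun x => by simp [C', memN]
  have cc : C.card + C'.card = 10 := by
    rw [← cN]; exact Finset.card_filter_add_card_filter_not _
  have ceq : C.card = C'.card := by
    apply Finset.card_bij' (fun x _ => t p x) (fun x _ => t p x)
    · intro x hx
      rw [memC] at hx
      rw [memC']
      rcases key p q hpq hn x hx.1 with h5 | h5
      · exact ⟨(ht p x hx.1).1, h5.2⟩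
      · exact absurd hx.2 h5.1
    · intro x hx
      rw [memC'] at hx
      rw [memC]
      rcases key p q hpq hn x hx.1 with h5 | h5
      · exact absurd h5.1 hx.2
      · exact ⟨(ht p x hx.1).1, h5.2⟩
    · intro x hx
      exact inv p x ((memC x).mp hx).1
    · intro x hx
      exact inv p x ((memC' x).mp hx).1
  have c5 : C.card = 5 := by omega
  let ev := C.equivFinOfCardEq c5
  let c : Fin 5 → L := fun i => (ev.symm i : L)
  have hc : ∀ i, A p (c i) ∧ A q (c i) := fun i => (memC _).mp (ev.symm i).2
  have cinj : ∀ i j, i ≠ j → c i ≠ c j := fun i j hij he =>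
    hij (ev.symm.injective (Subtype.ext he))
  have csurj : ∀ x, A p x → A q x → ∃ i, c i = x := fun x h1 h2 =>
    ⟨ev ⟨x, (memC x).mpr ⟨h1, h2⟩⟩, by simp [c]⟩
  -- properties of `b i = t p (c i)` and symmetric ones
  have P : ∀ r s : L, r ≠ s → ¬ A r s → (∀ i, A r (c i) ∧ A s (c i)) →
      (∀ i, A r (t r (c i)) ∧ ¬ A s (t r (c i)) ∧ t r (c i) ≠ s ∧ A (c i) (t r (c i))) ∧
      (∀ i j, i ≠ j → t r (c i) ≠ t r (c j) ∧ ¬ A (t r (c i)) (t r (c j)) ∧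
        ¬ A (c i) (t r (c j))) := by
    intro r s hrs hns hc
    have first : ∀ i, A r (t r (c i)) ∧ ¬ A s (t r (c i)) ∧ t r (c i) ≠ s ∧
        A (c i) (t r (c i)) := by
      intro i
      have h1 := ht r (c i) (hc i).1
      refine ⟨h1.1, ?_, ?_, h1.2.1⟩
      · rcases key r s hrs hns (c i) (hc i).1 with h5 | h5
        · exact h5.2
        · exact absurd (hc i).2 h5.1
      · intro h5
        exact hns (h5 ▸ h1.1)
    have ne : ∀ i j, i ≠ j → t r (c i) ≠ t r (c j) := by
      intro i j hij h5
      apply cinj i j hij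
      rw [← inv r _ (hc i).1, h5, inv r _ (hc j).1]
    refine ⟨first, fun i j hij => ⟨ne i j hij, ?_, ?_⟩⟩
    · intro h5
      have := uniq r _ _ (first i).1 (first j).1 h5
      rw [inv r _ (hc i).1] at this
      exact (first j).2.1 (this ▸ (hc i).2)
    · intro h5
      exact ne i j hij (uniq r _ _ (hc i).1 (first j).1 h5).symm
  obtain ⟨b1, b2⟩ := P p q hpq hn hc
  obtain ⟨a1, a2⟩ := P q p hpq.symm hnq (fun i => (hc i).symm)
  let a : Fin 6 → L := Fin.cons p (fun i => t q (c i))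
  let b : Fin 6 → L := Fin.cons q (fun i => t p (c i))
  have nadj : ∀ x y, ¬ A x y → ¬ A y x := fun x y h0 h5 => h0 (h.symm _ _ h5)
  refine ⟨a, b, ⟨?_, ?_, ?_, ?_⟩, rfl, rfl, ?_⟩
  · intro i j
    refine Fin.cases ?_ (fun i => ?_) i <;> refine Fin.cases ?_ (fun j => ?_) j <;> intro hij
    · exact absurd rfl hij
    · exact ⟨(a1 j).2.2.1.symm, (a1 j).2.1⟩
    · exact ⟨(a1 i).2.2.1, nadj _ _ (a1 i).2.1⟩
    · have := a2 i j (fun h0 => hij (by rw [h0]))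
      exact ⟨this.1, this.2.1⟩
  · intro i j
    refine Fin.cases ?_ (fun i => ?_) i <;> refine Fin.cases ?_ (fun j => ?_) j <;> intro hij
    · exact absurd rfl hij
    · exact ⟨(b1 j).2.2.1.symm, (b1 j).2.1⟩
    · exact ⟨(b1 i).2.2.1, nadj _ _ (b1 i).2.1⟩
    · have := b2 i j (fun h0 => hij (by rw [h0]))
      exact ⟨this.1, this.2.1⟩
  · intro i
    refine Fin.cases ?_ (fun i => ?_) i
    · exact ⟨hpq, hn⟩
    · refine ⟨fun h5 => ?_, fun h5 => ?_⟩
      · have h6 : t q (c i) = t p (c i) := h5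
        exact (b1 i).2.1 (h6 ▸ (a1 i).1)
      · have h6 : A (t q (c i)) (t p (c i)) := h5
        have e1 := uniq (c i) (t p (c i)) (t q (c i)) (b1 i).2.2.2 (a1 i).2.2.2 (h.symm _ _ h6)
        have e2 := uniq (c i) (t p (c i)) p (b1 i).2.2.2 (h.symm _ _ (hc i).1)
          (h.symm _ _ (b1 i).1)
        exact (a1 i).2.2.1 (e1.trans e2.symm)
  · intro i j
    refine Fin.cases ?_ (fun i => ?_) i <;> refine Fin.cases ?_ (fun j => ?_) j <;> intro hij
    · exact absurd rfl hij
    · exact (b1 j).1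
    · exact h.symm _ _ (a1 i).1
    · have hij' : i ≠ j := fun h0 => hij (by rw [h0])
      change A (t q (c i)) (t p (c j))
      obtain ⟨-, -, -, h4⟩ := ht q (c i) (hc i).2
      rcases h4 (t p (c j)) with h5 | h5 | h5 | h5 | h5 | h5
      · exact absurd h5 (b1 j).2.2.1
      · exact absurd ((h5.symm ▸ (hc i).2 : A q (t p (c j)))) (b1 j).2.1
      · exact absurd ((h5.symm ▸ (a1 i).1 : A q (t p (c j)))) (b1 j).2.1
      · exact absurd (h.symm _ _ h5) (b1 j).2.1
      · exact absurd (h.symm _ _ h5) (b2 i j hij').2.2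
      · exact h.symm _ _ h5
  · ext x
    simp only [Set.mem_union, Set.mem_range, DD, Set.mem_ofPred_eq]
    constructor
    · rintro (⟨i, rfl⟩ | ⟨i, rfl⟩)
      · refine Fin.cases ?_ (fun i => ?_) i
        · exact Or.inl rfl
        · exact Or.inr (Or.inr (Or.inr ⟨(a1 i).1, (a1 i).2.1⟩))
      · refine Fin.cases ?_ (fun i => ?_) i
        · exact Or.inr (Or.inl rfl)
        · exact Or.inr (Or.inr (Or.inl ⟨(b1 i).1, (b1 i).2.1⟩))
    · rintro (rfl | rfl | ⟨h1, h2⟩ | ⟨h1, h2⟩)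
      · exact Or.inl ⟨0, rfl⟩
      · exact Or.inr ⟨0, rfl⟩
      · rcases key p q hpq hn x h1 with h5 | h5
        · exact absurd h5.1 h2
        · obtain ⟨i, hi⟩ := csurj _ (ht p x h1).1 h5.2
          refine Or.inr ⟨i.succ, ?_⟩
          change t p (c i) = x
          rw [hi, inv p x h1]
      · rcases key q p hpq.symm hnq x h1 with h5 | h5
        · exact absurd h5.1 h2
        · obtain ⟨i, hi⟩ := csurj _ h5.2 (ht q x h1).1
          refine Or.inl ⟨i.succ, ?_⟩
          change t q (c i) = x
          rw [hi, inv q x h1]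

lemma DS.symm (h : GQ A) {a b : Fin 6 → L} (d : DS A a b) : DS A b a :=
  ⟨d.bb, d.aa, fun i => ⟨(d.ab i).1.symm, fun h0 => (d.ab i).2 (h.symm _ _ h0)⟩,
    fun i j hij => h.symm _ _ (d.mt j i hij.symm)⟩

lemma DS.ne (h : GQ A) {a b : Fin 6 → L} (d : DS A a b) (i j : Fin 6) : a i ≠ b j := by
  by_cases hij : i = j
  · subst hij; exact (d.ab i).1
  · intro h0
    have := d.mt i j hij
    rw [h0] at this
    exact h.irr _ this

lemma DS.inj (h : GQ A) {a b : Fin 6 → L} (d : DS A a b) : Function.Injective (Sum.elim a b) := by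
  rintro (i | i) (j | j) hij <;> simp only [Sum.elim_inl, Sum.elim_inr] at hij
  · by_contra hne
    exact (d.aa i j (fun h0 => hne (by rw [h0]))).1 hij
  · exact absurd hij (d.ne h i j)
  · exact absurd hij.symm (d.ne h j i)
  · by_contra hne
    exact (d.bb i j (fun h0 => hne (by rw [h0]))).1 hij

lemma DS.ncard (h : GQ A) {a b : Fin 6 → L} (d : DS A a b) :
    (Set.range a ∪ Set.range b).ncard = 12 := by
  rw [← Set.Sum.elim_range, ← Set.image_univ, Set.ncard_image_of_injective _ (d.inj h),
    Set.ncard_univ]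
  simp

lemma DS.eq_DD (h : GQ A) [Finite L] {a b : Fin 6 → L} (d : DS A a b) (i : Fin 6) :
    Set.range a ∪ Set.range b = DD A (a i) (b i) := by
  apply Set.eq_of_subset_of_ncard_le
  · rintro x (⟨j, rfl⟩ | ⟨j, rfl⟩)
    · by_cases hij : j = i
      · subst hij; exact Or.inl rfl
      · exact Or.inr (Or.inr (Or.inr ⟨h.symm _ _ (d.mt j i hij), (d.aa i j (Ne.symm hij)).2⟩))
    · by_cases hij : j = i
      · subst hij; exact Or.inr (Or.inl rfl)
      · exact Or.inr (Or.inr (Or.inl ⟨d.mt i j (Ne.symm hij), (d.bb i j (Ne.symm hij)).2⟩))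
  · obtain ⟨a', b', d', -, -, e⟩ := h.build (d.ab i).1 (d.ab i).2
    rw [d.ncard h, ← e, d'.ncard h]
  · exact Set.toFinite _

lemma exists_third_index (i j : Fin 6) : ∃ m, m ≠ i ∧ m ≠ j := by
  revert i j; decide

lemma DS.pair_cases (h : GQ A) {a b : Fin 6 → L} (d : DS A a b) {p q : L} (hpq : p ≠ q)
    (hn : ¬ A p q) (e : Set.range a ∪ Set.range b = DD A p q) :
    ∃ i, (p = a i ∧ q = b i) ∨ (p = b i ∧ q = a i) := by
  have hp : p ∈ Set.range a ∪ Set.range b := by rw [e]; exact Or.inl rfl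
  have hq : q ∈ Set.range a ∪ Set.range b := by rw [e]; exact Or.inr (Or.inl rfl)
  have main : ∀ a b : Fin 6 → L, DS A a b → Set.range a ∪ Set.range b = DD A p q →
      ∀ i j, p = a i → q = a j → False := by
    intro a b d e i j hi hj
    obtain ⟨m, m1, m2⟩ := exists_third_index i j
    have : a m ∈ DD A p q := by rw [← e]; exact Or.inl ⟨m, rfl⟩
    rw [hi, hj] at this
    rcases this with h5 | h5 | h5 | h5
    · exact (d.aa m i m1).1 h5
    · exact (d.aa m j m2).1 h5
    · exact (d.aa i m m1.symm).2 h5.1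
    · exact (d.aa j m m2.symm).2 h5.1
  rcases hp with ⟨i, rfl⟩ | ⟨i, rfl⟩ <;> rcases hq with ⟨j, rfl⟩ | ⟨j, rfl⟩
  · exact (main a b d e i j rfl rfl).elim
  · by_cases hij : i = j
    · subst hij; exact ⟨i, Or.inl ⟨rfl, rfl⟩⟩
    · exact absurd (d.mt i j hij) hn
  · by_cases hij : i = j
    · subst hij; exact ⟨i, Or.inr ⟨rfl, rfl⟩⟩
    · exact absurd (h.symm _ _ (d.mt j i (Ne.symm hij))) hn
  · exact (main b a (d.symm h) (by rw [Set.union_comm]; exact e) i j rfl rfl).elim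

lemma GQ.count (h : GQ A) [Nonempty L] :
    {S : Set L | ∃ a b : Fin 6 → L, DS A a b ∧ S = Set.range a ∪ Set.range b}.ncard = 36 := by
  classical
  have := h.finite
  have := Fintype.ofFinite L
  let X : Finset (L × L) := Finset.univ.filter (fun x => x.1 ≠ x.2 ∧ ¬ A x.1 x.2)
  have memX : ∀ x, x ∈ X ↔ x.1 ≠ x.2 ∧ ¬ A x.1 x.2 := fun x => by simp [X]
  let f : L × L → Set L := fun x => DD A x.1 x.2
  have hset : {S : Set L | ∃ a b : Fin 6 → L, DS A a b ∧ S = Set.range a ∪ Set.range b} =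
      ((X.image f : Finset (Set L)) : Set (Set L)) := by
    ext S
    simp only [Set.mem_ofPred_eq, Finset.coe_image, Set.mem_image, Finset.mem_coe]
    constructor
    · rintro ⟨a, b, d, rfl⟩
      exact ⟨(a 0, b 0), (memX _).mpr (d.ab 0), (d.eq_DD h 0).symm⟩
    · rintro ⟨⟨p, q⟩, hx, rfl⟩
      obtain ⟨h1, h2⟩ := (memX _).mp hx
      obtain ⟨a, b, d, -, -, e⟩ := h.build h1 h2
      exact ⟨a, b, d, e.symm⟩
  rw [hset, Set.ncard_coe_finset]
  have hfib : ∀ S ∈ X.image f, (X.filter (fun x => f x = S)).card = 12 := by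
    intro S hS
    have hS' : S ∈ {S : Set L | ∃ a b : Fin 6 → L, DS A a b ∧
        S = Set.range a ∪ Set.range b} := by rw [hset]; exact hS
    obtain ⟨a, b, d, rfl⟩ := hS'
    let g : Fin 6 ⊕ Fin 6 → L × L := Sum.elim (fun i => (a i, b i)) (fun i => (b i, a i))
    have gi : Function.Injective g := by
      intro x y hxy
      apply d.inj h
      have h1 := congrArg Prod.fst hxy
      rcases x with x | x <;> rcases y with y | y <;> exact h1
    have : X.filter (fun x => f x = Set.range a ∪ Set.range b) = Finset.univ.image g := by
      ext ⟨p, q⟩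
      simp only [Finset.mem_filter, memX, Finset.mem_image, Finset.mem_univ, true_and]
      constructor
      · rintro ⟨⟨h1, h2⟩, h3⟩
        obtain ⟨i, ⟨rfl, rfl⟩ | ⟨rfl, rfl⟩⟩ := d.pair_cases h h1 h2 h3.symm
        · exact ⟨Sum.inl i, rfl⟩
        · exact ⟨Sum.inr i, rfl⟩
      · rintro ⟨i | i, hi⟩
        · obtain ⟨rfl, rfl⟩ := Prod.mk.inj hi
          exact ⟨d.ab i, (d.eq_DD h i).symm⟩
        · obtain ⟨rfl, rfl⟩ := Prod.mk.inj hi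
          refine ⟨(d.symm h).ab i, ?_⟩
          rw [Set.union_comm]
          exact ((d.symm h).eq_DD h i).symm
    rw [this, Finset.card_image_of_injective _ gi]
    simp
  have hX : X.card = (X.image f).card * 12 := by
    rw [Finset.card_eq_sum_card_image f X, Finset.sum_congr rfl hfib, Finset.sum_const,
      smul_eq_mul]
  have hX2 : X.card = 27 * 16 := by
    have : X.card = ∑ p : L, (Finset.univ.filter (fun q => p ≠ q ∧ ¬ A p q)).card := by
      rw [← Finset.card_sigma]
      apply Finset.card_bij' (fun x _ => ⟨x.1, x.2⟩) (fun x _ => (x.1, x.2))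
      · rintro ⟨p, q⟩ hx; rfl
      · rintro ⟨p, q⟩ hx; rfl
      · rintro ⟨p, q⟩ hx; simpa [X] using hx
      · rintro ⟨p, q⟩ hx; simpa [X] using hx
    rw [this, Finset.sum_congr rfl (g := fun _ => 16), Finset.sum_const, Finset.card_univ, h.card,
      smul_eq_mul]
    intro p _
    have e : Finset.univ.filter (fun q => p ≠ q ∧ ¬ A p q) =
        (insert p (Finset.univ.filter (A p)))ᶜ := by
      ext q
      simp [eq_comm]
    rw [e, Finset.card_compl, Finset.card_insert_of_notMem (by simpa using h.irr p), h.cardN,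
      h.card]
  omega

end Comb

section Glue
variable {k : Type} [Field k] {V : Type} [AddCommGroup V] [Module k V]
variable {T : V →ₗ[k] V →ₗ[k] V →ₗ[k] k}

lemma LN.ne_bot {W : Submodule k V} (h : LN T W) : W ≠ ⊥ := by
  rintro rfl
  have := h.1
  rw [finrank_bot] at this
  omega

/-- Incidence of two distinct lines. -/
def Inc (T : V →ₗ[k] V →ₗ[k] V →ₗ[k] k) (x y : {W : Submodule k V // LN T W}) : Prop :=
  x ≠ y ∧ x.1 ⊓ y.1 ≠ ⊥

lemma disj_iff (x y : {W : Submodule k V // LN T W}) :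
    x.1 ⊓ y.1 = ⊥ ↔ x ≠ y ∧ ¬ Inc T x y := by
  constructor
  · intro h
    refine ⟨?_, fun h2 => h2.2 h⟩
    rintro rfl
    rw [inf_idem] at h
    exact x.2.ne_bot h
  · rintro ⟨h1, h2⟩
    by_contra h3
    exact h2 ⟨h1, h3⟩

lemma SC.gq [FiniteDimensional k V] [IsAlgClosed k] [CharZero k] (h : SC T) : GQ (Inc T) where
  symm := by
    rintro x y ⟨h1, h2⟩
    exact ⟨h1.symm, by rwa [inf_comm]⟩
  irr := fun x hx => hx.1 rfl
  third := by
    have : ∀ x y : {W : Submodule k V // LN T W}, ∃ z : {W : Submodule k V // LN T W},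
        Inc T x y → Tri T x.1 y.1 z.1 := by
      intro x y
      by_cases hxy : Inc T x y
      · obtain ⟨n, hn⟩ := h.third x.2 y.2 (fun e => hxy.1 (Subtype.ext e)) hxy.2
        exact ⟨⟨n, hn.hn⟩, fun _ => hn⟩
      · exact ⟨x, fun h => absurd h hxy⟩
    choose t ht using this
    refine ⟨t, fun x y hxy => ?_⟩
    have tr := ht x y hxy
    refine ⟨⟨fun e => tr.nl (congrArg Subtype.val e.symm), tr.rot.meet⟩,
      ⟨fun e => tr.nm (congrArg Subtype.val e.symm), tr.swap.rot.meet⟩, ?_, ?_⟩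
    · intro p h1 h2
      rcases h.two_meet tr p.2 h1.2 h2.2 with e | e | e
      · exact absurd (Subtype.ext e) h1.1
      · exact absurd (Subtype.ext e) h2.1
      · exact Subtype.ext e
    · intro p
      by_cases e1 : p = x
      · exact Or.inl e1
      by_cases e2 : p = y
      · exact Or.inr (Or.inl e2)
      by_cases e3 : p = t x y
      · exact Or.inr (Or.inr (Or.inl e3))
      rcases h.some_meet tr p.2 with h1 | h1 | h1
      · exact Or.inr (Or.inr (Or.inr (Or.inl ⟨e1, h1⟩)))
      · exact Or.inr (Or.inr (Or.inr (Or.inr (Or.inl ⟨e2, h1⟩))))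
      · exact Or.inr (Or.inr (Or.inr (Or.inr (Or.inr ⟨e3, h1⟩))))
  deg := by
    intro l
    obtain ⟨m, m', tr, hne, hall⟩ := h.five l.2
    refine ⟨Sum.elim (fun i => ⟨m i, (tr i).hm⟩) (fun i => ⟨m' i, (tr i).hn⟩), ?_, ?_⟩
    · rintro (i | i) (j | j) e
      · by_contra hc
        exact (hne i j (fun e => hc (by rw [e]))).1 (congrArg Subtype.val e)
      · exfalso
        have e' : m i = m' j := congrArg Subtype.val e
        by_cases hij : i = j
        · subst hij
          exact (tr i).nm e'.symm
        · exact (hne i j hij).2.1 e'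
      · exfalso
        have e' : m' i = m j := congrArg Subtype.val e
        by_cases hij : i = j
        · subst hij
          exact (tr i).nm e'
        · exact (hne j i (Ne.symm hij)).2.1 e'.symm
      · by_contra hc
        exact (hne i j (fun e => hc (by rw [e]))).2.2 (congrArg Subtype.val e)
    · intro x
      constructor
      · rintro ⟨h1, h2⟩
        obtain ⟨i, e | e⟩ := hall x.1 x.2 (fun e => h1 (Subtype.ext e.symm))
          (by rwa [inf_comm])
        · exact ⟨Sum.inl i, Subtype.ext e.symm⟩
        · exact ⟨Sum.inr i, Subtype.ext e.symm⟩
      · rintro ⟨i | i, rfl⟩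
        · exact ⟨fun e => (tr i).lm (congrArg Subtype.val e), (tr i).meet⟩
        · exact ⟨fun e => (tr i).nl (congrArg Subtype.val e.symm), (tr i).rot.meet⟩

end Glue
lemma isLineOn_iff {k : Type} [Field k] [CharZero k] {F : MvPolynomial (Fin 4) k}
    (hF : F.IsHomogeneous 3) (W : Submodule k (Fin 4 → k)) :
    IsLineOn F W ↔ LN (TF F) W := by
  unfold IsLineOn LN
  simp only [TF_self hF]

/-- **Schläfli.** A smooth cubic surface contains exactly 36 double sixes: the collection
of sets of lines on the surface that can be enumerated by two 6-tuples forming a double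
six has exactly 36 elements. -/
theorem thirtySix_double_sixes
    (k : Type) [Field k] [IsAlgClosed k] [CharZero k]
    (F : MvPolynomial (Fin 4) k) (hhom : F.IsHomogeneous 3)
    (hsmooth : ∀ v : Fin 4 → k, (∀ i : Fin 4, eval v (pderiv i F) = 0) → v = 0) :
    {T : Set (Submodule k (Fin 4 → k)) |
        ∃ ℓ ℓ' : Fin 6 → Submodule k (Fin 4 → k),
          IsDoubleSix F ℓ ℓ' ∧ T = Set.range ℓ ∪ Set.range ℓ'}.ncard = 36 := by
  have h := TF_SC hhom hsmooth
  obtain ⟨W, hW⟩ := TF_exists_line hhom hsmooth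
  haveI : Nonempty {W : Submodule k (Fin 4 → k) // LN (TF F) W} := ⟨⟨W, hW⟩⟩
  rw [← h.gq.count, ← Set.ncard_image_of_injective _
    (Subtype.val_injective (p := fun W => LN (TF F) W)).image_injective]
  congr 1
  ext S
  simp only [Set.mem_image, Set.mem_ofPred_eq]
  constructor
  · rintro ⟨ℓ, ℓ', ⟨⟨hl, ha⟩, ⟨hl', hb⟩, hab, hmt⟩, rfl⟩
    let a : Fin 6 → {W : Submodule k (Fin 4 → k) // LN (TF F) W} :=
      fun i => ⟨ℓ i, (isLineOn_iff hhom _).mp (hl i)⟩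
    let b : Fin 6 → {W : Submodule k (Fin 4 → k) // LN (TF F) W} :=
      fun i => ⟨ℓ' i, (isLineOn_iff hhom _).mp (hl' i)⟩
    refine ⟨Set.range a ∪ Set.range b, ⟨a, b, ⟨?_, ?_, ?_, ?_⟩, rfl⟩, ?_⟩
    · exact fun i j hij => (disj_iff (a i) (a j)).mp (ha i j hij)
    · exact fun i j hij => (disj_iff (b i) (b j)).mp (hb i j hij)
    · exact fun i => (disj_iff (a i) (b i)).mp (hab i)
    · intro i j hij
      refine ⟨?_, hmt i j hij⟩
      intro e
      have e' : ℓ i = ℓ' j := congrArg Subtype.val e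
      obtain ⟨m, m1, m2⟩ := exists_third_index i j
      apply hmt m j m2
      rw [← e']
      exact ha m i m1
    · rw [Set.image_union, ← Set.range_comp, ← Set.range_comp]
      rfl
  · rintro ⟨S, ⟨a, b, d, rfl⟩, rfl⟩
    refine ⟨fun i => (a i).1, fun i => (b i).1,
      ⟨⟨fun i => (isLineOn_iff hhom _).mpr (a i).2, ?_⟩,
      ⟨fun i => (isLineOn_iff hhom _).mpr (b i).2, ?_⟩, ?_, ?_⟩, ?_⟩
    · exact fun i j hij => (disj_iff (a i) (a j)).mpr (d.aa i j hij)
    · exact fun i j hij => (disj_iff (b i) (b j)).mpr (d.bb i j hij)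
    · exact fun i => (disj_iff (a i) (b i)).mpr (d.ab i)
    · exact fun i j hij => (d.mt i j hij).2
    · rw [Set.image_union, ← Set.range_comp, ← Set.range_comp]
      rfl
end

section
/- Let B be a commutative Noetherian ring and let A be a smooth B-algebra (formally smooth and of finite presentation). Let I ⊆ A be an ideal generated by a regular sequence (i.e. there is a finite sequence of elements of A that is a regular sequence on A and generates I) such that the quotient ring A/I is flat as a B-module. Then the Rees algebra R_I(A) = ⊕_{n ≥ 0} Iⁿ (the subalgebra of the polynomial ring A[X] generated by A together with the elements a·X for a ∈ I) is flat as a B-module. -/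
/-- A list `rs` of elements of a commutative ring `A` is a *regular sequence* if each
entry is a nonzerodivisor modulo the ideal generated by the previous entries, and the
ideal generated by all entries is proper. -/
def IsRegularSeq {A : Type*} [CommRing A] (rs : List A) : Prop :=
  (∀ i : Fin rs.length, ∀ x : A,
      rs.get i * x ∈ Ideal.span {a | a ∈ rs.take i} →
        x ∈ Ideal.span {a | a ∈ rs.take i}) ∧
    Ideal.span {a | a ∈ rs} ≠ ⊤

namespace ReesFlat

/-- The quotient `N / K N` for ideals `K`, `N`. -/
abbrev Q {A : Type} [CommRing A] (N K : Ideal A) : Type := ↥N ⧸ (K * N).submoduleOf N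

section
variable {A : Type} [CommRing A]

lemma pow_decomp {I J : Ideal A} {a : A} (hI : I = J ⊔ Ideal.span {a}) (n : ℕ) :
    I ^ (n + 1) = J ^ (n + 1) ⊔ Ideal.span {a} * I ^ n := by
  apply le_antisymm
  · induction n with
    | zero => simp [hI]
    | succ n ih =>
      have h1 : I ^ (n + 1 + 1) = J * I ^ (n + 1) ⊔ Ideal.span {a} * I ^ (n + 1) := by
        rw [pow_succ' I (n + 1), ← Ideal.sup_mul, ← hI]
      rw [h1]
      refine sup_le ?_ le_sup_right
      refine (Ideal.mul_mono_right ih).trans ?_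
      rw [Ideal.mul_sup]
      refine sup_le ?_ ?_
      · rw [← pow_succ']; exact le_sup_left
      · refine le_trans ?_ le_sup_right
        rw [mul_left_comm, pow_succ' I n]
        exact Ideal.mul_mono_right (Ideal.mul_mono_left (hI ▸ le_sup_left))
  · refine sup_le (Ideal.pow_right_mono (hI ▸ le_sup_left) _) ?_
    rw [pow_succ' I n]
    exact Ideal.mul_mono_left (hI ▸ le_sup_right)

lemma step {I J K : Ideal A} {a : A} (hI : I = J ⊔ Ideal.span {a}) (hIK : I ≤ K)
    (ha : ∀ n x, a * x ∈ J ^ n → x ∈ J ^ n) (n : ℕ) :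
    Nonempty ((Q (I ^ n) K × Q (J ^ (n + 1)) K) ≃ₗ[A] Q (I ^ (n + 1)) K) := by
  have hJI : J ≤ I := hI ▸ le_sup_left
  have haI : a ∈ I := by
    rw [hI]; exact Ideal.mem_sup_right (Ideal.mem_span_singleton_self a)
  have hJn : J ^ (n + 1) ≤ I ^ (n + 1) := Ideal.pow_right_mono hJI _
  have hmul : ∀ x ∈ I ^ n, a * x ∈ I ^ (n + 1) := fun x hx => by
    rw [pow_succ']; exact Ideal.mul_mem_mul haI hx
  let f1 : ↥(I ^ n) →ₗ[A] ↥(I ^ (n + 1)) :=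
    (LinearMap.mulLeft A a).restrict hmul
  let f2 : ↥(J ^ (n + 1)) →ₗ[A] ↥(I ^ (n + 1)) := Submodule.inclusion hJn
  have hf1 : (K * I ^ n).submoduleOf (I ^ n) ≤
      ((K * I ^ (n + 1)).submoduleOf (I ^ (n + 1))).comap f1 := by
    intro x hx
    have hx' : (x : A) ∈ K * I ^ n := hx
    change a * (x : A) ∈ K * I ^ (n + 1)
    rw [pow_succ', mul_left_comm]
    exact Ideal.mul_mem_mul haI hx'
  have hf2 : (K * J ^ (n + 1)).submoduleOf (J ^ (n + 1)) ≤
      ((K * I ^ (n + 1)).submoduleOf (I ^ (n + 1))).comap f2 := by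
    intro x hx
    have hx' : (x : A) ∈ K * J ^ (n + 1) := hx
    change (x : A) ∈ K * I ^ (n + 1)
    exact Ideal.mul_mono_right hJn hx'
  let F := (Submodule.mapQ _ _ f1 hf1).coprod (Submodule.mapQ _ _ f2 hf2)
  refine ⟨LinearEquiv.ofBijective F ⟨?_, ?_⟩⟩
  · rw [← LinearMap.ker_eq_bot, LinearMap.ker_eq_bot']
    rintro ⟨x, y⟩ h
    obtain ⟨x, rfl⟩ := Submodule.Quotient.mk_surjective _ x
    obtain ⟨y, rfl⟩ := Submodule.Quotient.mk_surjective _ y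
    have h' : Submodule.Quotient.mk (p := (K * I ^ (n + 1)).submoduleOf (I ^ (n + 1)))
        (f1 x + f2 y) = 0 := h
    rw [Submodule.Quotient.mk_eq_zero] at h'
    have h2 : a * (x : A) + (y : A) ∈ K * I ^ (n + 1) := h'
    rw [pow_decomp hI, Ideal.mul_sup, mul_left_comm] at h2
    obtain ⟨y', hy', z, hz, hyz⟩ := Submodule.mem_sup.mp h2
    obtain ⟨x', hx', rfl⟩ := Ideal.mem_span_singleton_mul.mp hz
    have e : a * ((x : A) - x') = y' - y := by linear_combination -hyz
    have hxx : (x : A) - x' ∈ J ^ (n + 1) := by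
      apply ha
      rw [e]
      exact sub_mem ((Ideal.mul_le_right : K * J ^ (n + 1) ≤ J ^ (n + 1)) hy') y.2
    have hxx2 : (x : A) - x' ∈ K * I ^ n := by
      rw [pow_succ'] at hxx
      exact Ideal.mul_mono (hJI.trans hIK) (Ideal.pow_right_mono hJI _) hxx
    have hx : (x : A) ∈ K * I ^ n := by
      have := add_mem hxx2 hx'
      simpa using this
    have hy : (y : A) ∈ K * J ^ (n + 1) := by
      have h3 : a * ((x : A) - x') ∈ K * J ^ (n + 1) := Ideal.mul_mem_mul (hIK haI) hxx
      have := sub_mem hy' h3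
      rw [e] at this
      simpa using this
    refine Prod.ext ?_ ?_
    · exact (Submodule.Quotient.mk_eq_zero _).mpr hx
    · exact (Submodule.Quotient.mk_eq_zero _).mpr hy
  · intro z
    obtain ⟨⟨z, hz⟩, rfl⟩ := Submodule.Quotient.mk_surjective _ z
    have hz2 := hz
    rw [pow_decomp hI] at hz2
    obtain ⟨y, hy, w, hw, hyw⟩ := Submodule.mem_sup.mp hz2
    obtain ⟨x, hx, rfl⟩ := Ideal.mem_span_singleton_mul.mp hw
    refine ⟨(Submodule.Quotient.mk ⟨x, hx⟩, Submodule.Quotient.mk ⟨y, hy⟩), ?_⟩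
    change Submodule.Quotient.mk (f1 ⟨x, hx⟩ + f2 ⟨y, hy⟩) = _
    congr 1
    apply Subtype.ext
    change a * x + y = z
    rw [← hyw, add_comm]

lemma zero_case (I K : Ideal A) : Nonempty (Q (I ^ 0) K ≃ₗ[A] (Unit →₀ (A ⧸ K))) := by
  have h : I ^ 0 = ⊤ := by simp
  let e : ↥(I ^ 0) ≃ₗ[A] A := (LinearEquiv.ofEq _ _ h).trans Submodule.topEquiv
  have he : ∀ x : ↥(I ^ 0), e x = (x : A) := fun x => rfl
  refine ⟨(Submodule.Quotient.equiv _ K e ?_).trans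
    (Finsupp.uniqueLinearEquiv A (A ⧸ K) ()).symm⟩
  ext x
  simp only [Submodule.mem_map]
  constructor
  · rintro ⟨y, hy, rfl⟩
    exact (Ideal.mul_le_left : K * I ^ 0 ≤ K) (show (y : A) ∈ K * I ^ 0 from hy)
  · intro hx
    refine ⟨⟨x, by simp⟩, ?_, rfl⟩
    change x ∈ K * I ^ 0
    simpa using hx

/-- Freeness of `J^n / K J^n` implies that nonzerodivisors mod `J` are such mod `J^n`. -/
lemma regular_pow {J : Ideal A} {a : A} (ha : ∀ x, a * x ∈ J → x ∈ J)
    (hfree : ∀ n, ∃ ι : Type, Nonempty (Q (J ^ n) J ≃ₗ[A] (ι →₀ (A ⧸ J)))) (n : ℕ) :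
    ∀ x, a * x ∈ J ^ n → x ∈ J ^ n := by
  induction n with
  | zero => simp
  | succ n ih =>
    intro x hx
    have hxn : x ∈ J ^ n := ih x (Ideal.pow_le_pow_right (Nat.le_succ n) hx)
    obtain ⟨ι, ⟨e⟩⟩ := hfree n
    let q : Q (J ^ n) J := Submodule.Quotient.mk ⟨x, hxn⟩
    have hq : a • q = 0 := by
      change Submodule.Quotient.mk (a • (⟨x, hxn⟩ : ↥(J ^ n))) = _
      rw [Submodule.Quotient.mk_eq_zero]
      change a * x ∈ J * J ^ n
      rwa [← pow_succ']
    have hq0 : q = 0 := by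
      apply e.injective
      rw [map_zero]
      have h1 : a • e q = 0 := by rw [← map_smul, hq, map_zero]
      ext i
      have h2 : a • (e q i) = 0 := by rw [← Finsupp.smul_apply, h1]; rfl
      obtain ⟨y, hy⟩ := Ideal.Quotient.mk_surjective (e q i)
      rw [← hy] at h2 ⊢
      have h3 : Ideal.Quotient.mk J (a * y) = 0 := h2
      exact Ideal.Quotient.eq_zero_iff_mem.mpr (ha y (Ideal.Quotient.eq_zero_iff_mem.mp h3))
    rw [Submodule.Quotient.mk_eq_zero] at hq0
    rw [pow_succ']
    exact hq0

lemma free_main (rs : List A)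
    (h : ∀ i : Fin rs.length, ∀ x : A,
      rs.get i * x ∈ Ideal.span {a | a ∈ rs.take i} →
        x ∈ Ideal.span {a | a ∈ rs.take i}) (K : Ideal A)
    (hK : Ideal.span {a | a ∈ rs} ≤ K) (n : ℕ) :
    ∃ ι : Type, Nonempty (Q (Ideal.span {a | a ∈ rs} ^ n) K ≃ₗ[A] (ι →₀ (A ⧸ K))) := by
  induction rs using List.reverseRecOn generalizing K n with
  | nil =>
    rcases n with _ | n
    · exact ⟨Unit, zero_case _ _⟩
    · refine ⟨Empty, ?_⟩
      have h0 : Ideal.span {a : A | a ∈ ([] : List A)} ^ (n + 1) = ⊥ := by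
        simp [pow_succ]
      rw [h0]
      exact ⟨0⟩
  | append_singleton l a ih =>
    have hl : ∀ i : Fin l.length, ∀ x : A,
      l.get i * x ∈ Ideal.span {a | a ∈ l.take i} →
        x ∈ Ideal.span {a | a ∈ l.take i} := by
      intro i x
      have := h ⟨i, by simp⟩ x
      simpa [List.getElem_append_left, List.take_append_of_le_length i.2.le] using this
    have ha : ∀ x, a * x ∈ Ideal.span {a | a ∈ l} → x ∈ Ideal.span {a | a ∈ l} := by
      intro x
      have := h ⟨l.length, by simp⟩ x
      simpa using this
    have hI : Ideal.span {x | x ∈ l ++ [a]} = Ideal.span {x | x ∈ l} ⊔ Ideal.span {a} := by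
      rw [← Ideal.span_union]
      congr 1
      ext; simp [or_comm]
    have hreg := regular_pow ha (fun n => ih hl _ le_rfl n)
    induction n with
    | zero => exact ⟨Unit, zero_case _ _⟩
    | succ n ihn =>
      obtain ⟨ι, ⟨e⟩⟩ := ihn
      obtain ⟨κ, ⟨e'⟩⟩ := ih hl K (le_trans (hI ▸ le_sup_left) hK) (n + 1)
      obtain ⟨s⟩ := step hI hK hreg n
      exact ⟨ι ⊕ κ, ⟨s.symm.trans ((e.prodCongr e').trans
        (Finsupp.sumFinsuppLEquivProdFinsupp A).symm)⟩⟩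

end

section
variable {B : Type} [CommRing B]

lemma flat_ker {M N P : Type} [AddCommGroup M] [AddCommGroup N] [AddCommGroup P]
    [Module B M] [Module B N] [Module B P] [Module.Flat B N] [Module.Flat B P]
    (g : M →ₗ[B] N) (f : N →ₗ[B] P) (hg : Function.Injective g) (hf : Function.Surjective f)
    (H : Function.Exact g f) : Module.Flat B M := by
  rw [Module.Flat.iff_rTensor_preserves_injective_linearMap]
  intro X Y _ _ _ _ φ hφ
  have h1 := LinearMap.lTensor_injective_of_exact_of_flat f hf g hg H X
  have h2 := Module.Flat.rTensor_preserves_injective_linearMap (M := N) φ hφ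
  refine Function.Injective.of_comp (f := g.lTensor Y) ?_
  rw [← LinearMap.coe_comp, LinearMap.lTensor_comp_rTensor, ← LinearMap.rTensor_comp_lTensor,
    LinearMap.coe_comp]
  exact h2.comp h1

variable {A : Type} [CommRing A] [Algebra B A]

lemma flat_pow [Module.Flat B A] (I : Ideal A) [Module.Flat B (A ⧸ I)]
    (hfree : ∀ n, ∃ ι : Type, Nonempty (Q (I ^ n) I ≃ₗ[A] (ι →₀ (A ⧸ I)))) (n : ℕ) :
    Module.Flat B ↥(I ^ n) := by
  induction n with
  | zero =>
    have h : I ^ 0 = ⊤ := by simp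
    let e : ↥(I ^ 0) ≃ₗ[A] A := (LinearEquiv.ofEq _ _ h).trans Submodule.topEquiv
    exact Module.Flat.of_linearEquiv (e.restrictScalars B)
  | succ n ih =>
    obtain ⟨ι, ⟨e⟩⟩ := hfree n
    have : Module.Flat B (ι →₀ (A ⧸ I)) := by
      classical exact Module.Flat.of_linearEquiv (finsuppLequivDFinsupp B)
    have : Module.Flat B (Q (I ^ n) I) := Module.Flat.of_linearEquiv (e.restrictScalars B)
    have hle : I ^ (n + 1) ≤ I ^ n := Ideal.pow_le_pow_right (Nat.le_succ n)
    let g : ↥(I ^ (n + 1)) →ₗ[A] ↥(I ^ n) :=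
      Submodule.inclusion hle
    let f : ↥(I ^ n) →ₗ[A] Q (I ^ n) I := Submodule.mkQ _
    have hg : Function.Injective g := Submodule.inclusion_injective hle
    have hf : Function.Surjective f := Submodule.mkQ_surjective _
    refine flat_ker (g.restrictScalars B) (f.restrictScalars B) hg hf ?_
    intro x
    change f x = 0 ↔ x ∈ Set.range g
    have : f x = 0 ↔ (x : A) ∈ I ^ (n + 1) := by
      rw [pow_succ']
      exact Submodule.Quotient.mk_eq_zero _
    rw [this]
    constructor
    · intro hx
      exact ⟨⟨x, hx⟩, rfl⟩
    · rintro ⟨y, rfl⟩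
      exact y.2

open Polynomial in
lemma flat_rees (I : Ideal A) (h : ∀ n, Module.Flat B ↥(I ^ n)) :
    Module.Flat B (reesAlgebra I) := by
  classical
  let m (n : ℕ) : ↥(I ^ n) →ₗ[A] reesAlgebra I :=
    ((monomial n).comp (I ^ n).subtype).codRestrict (Subalgebra.toSubmodule (reesAlgebra I))
      (fun x => reesAlgebra.monomial_mem.mpr x.2)
  let F : (Π₀ n, ↥(I ^ n)) →ₗ[A] reesAlgebra I := DFinsupp.lsum ℕ m
  have hF : ∀ x n, (F x : A[X]).coeff n = x n := by
    intro x n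
    induction x using DFinsupp.induction with
    | h0 => simp
    | ha i b f _ _ ih =>
      rw [map_add]
      have : F (DFinsupp.single i b) = m i b := by simp [F]
      rw [this]
      change ((m i b : A[X]) + (F f : A[X])).coeff n = _
      rw [coeff_add, ih]
      change (monomial i (b : A)).coeff n + _ = _
      rw [coeff_monomial, DFinsupp.add_apply, DFinsupp.single_apply]
      split_ifs with hin
      · subst hin; simp
      · simp
  have hb : Function.Bijective F := by
    constructor
    · intro x y hxy
      ext n
      rw [← hF, ← hF, hxy]
    · intro p
      refine ⟨DFinsupp.mk (p : A[X]).support (fun n => ⟨(p : A[X]).coeff n, p.2 n⟩), ?_⟩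
      apply Subtype.ext
      ext n
      rw [hF, DFinsupp.mk_apply]
      split_ifs with hn
      · rfl
      · simpa using (notMem_support_iff.mp hn).symm
  exact Module.Flat.of_linearEquiv ((LinearEquiv.ofBijective F hb).symm.restrictScalars B)

end

end ReesFlat

theorem reesAlgebra_flat_of_regular_section
    (B : Type) [CommRing B] [IsNoetherianRing B]
    (A : Type) [CommRing A] [Algebra B A]
    [Algebra.FormallySmooth B A] (hfp : Algebra.FinitePresentation B A)
    (I : Ideal A) (rs : List A)
    (hgen : Ideal.span {a | a ∈ rs} = I)
    (hreg : IsRegularSeq rs)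
    (hflat : Module.Flat B (A ⧸ I)) :
    Module.Flat B (reesAlgebra I) := by
  have : Algebra.Smooth B A := { formallySmooth := inferInstance, finitePresentation := hfp }
  have : Module.Flat B A := inferInstance
  subst hgen
  exact ReesFlat.flat_rees _
    (ReesFlat.flat_pow _ (fun n => ReesFlat.free_main rs hreg.1 _ le_rfl n))
end

section
/- Let B be a commutative Noetherian ring, A a smooth B-algebra (formally smooth and of finite presentation), and I ⊆ A an ideal generated by a regular sequence such that A/I is flat as a B-module. Let C be any B-algebra, and let J ⊆ A ⊗_B C be the image of I under the canonical map A → A ⊗_B C (i.e. J = I·(A ⊗_B C)). Then the canonical C-algebra homomorphism R_I(A) ⊗_B C → R_J(A ⊗_B C) from the base change of the Rees algebra of I to the Rees algebra of J, induced by the inclusion R_I(A) ⊆ A[X] and the base change map A[X] ⊗_B C → (A ⊗_B C)[X], is an isomorphism. -/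
open TensorProduct

/-- The canonical `B`-algebra map `R_I(A) ⊗[B] C → (A ⊗[B] C)[X]`, induced by the
inclusion `R_I(A) ⊆ A[X]`, the base-change map `A[X] → (A ⊗_B C)[X]` on the first factor,
and the constant-polynomial inclusion of `C` via `A ⊗_B C` on the second factor. -/
noncomputable def reesBaseChangeMap
    (B : Type) [CommRing B] (A : Type) [CommRing A] [Algebra B A]
    (C : Type) [CommRing C] [Algebra B C] (I : Ideal A) :
    (reesAlgebra I) ⊗[B] C →ₐ[B] Polynomial (A ⊗[B] C) :=
  Algebra.TensorProduct.productMap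
    ((Polynomial.mapAlgHom
        (Algebra.TensorProduct.includeLeft : A →ₐ[B] A ⊗[B] C)).comp
      ((reesAlgebra I).val.restrictScalars B))
    ((IsScalarTower.toAlgHom B (A ⊗[B] C) (Polynomial (A ⊗[B] C))).comp
      Algebra.TensorProduct.includeRight)

/-- `J ^ n / J ^ (n+1)` is free over `A / J`, expressed elementwise. -/
def QuasiReg {A : Type} [CommRing A] (J : Ideal A) (n : ℕ) : Prop :=
  ∃ (ι : Type) (e : ι → A), (∀ i, e i ∈ J ^ n) ∧
    (∀ x ∈ J ^ n, ∃ c : ι →₀ A, x - Finsupp.linearCombination A e c ∈ J ^ (n + 1)) ∧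
    ∀ c : ι →₀ A, Finsupp.linearCombination A e c ∈ J ^ (n + 1) → ∀ i, c i ∈ J

section quasi
variable {A : Type} [CommRing A]

theorem lc_mem {ι : Type} {J : Ideal A} {e : ι → A} (he : ∀ i, e i ∈ J) (c : ι →₀ A) :
    Finsupp.linearCombination A e c ∈ J := by
  rw [Finsupp.linearCombination_apply]
  exact J.sum_mem fun i _ => J.mul_mem_left _ (he i)

theorem lc_mem' {ι : Type} {J K : Ideal A} {e : ι → A} (he : ∀ i, e i ∈ J) (c : ι →₀ A)
    (hc : ∀ i, c i ∈ K) : Finsupp.linearCombination A e c ∈ K * J := by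
  rw [Finsupp.linearCombination_apply]
  exact Ideal.sum_mem _ fun i _ => Ideal.mul_mem_mul (hc i) (he i)

theorem quasiReg_zero (J : Ideal A) : QuasiReg J 0 := by
  refine ⟨Unit, fun _ => 1, by simp, fun x _ => ⟨Finsupp.single () x, by simp⟩, ?_⟩
  intro c hc i
  simpa [Finsupp.linearCombination_apply, Finsupp.sum_fintype] using hc

theorem quasiReg_bot (n : ℕ) : QuasiReg (⊥ : Ideal A) n := by
  cases n with
  | zero => exact quasiReg_zero _
  | succ n =>
    refine ⟨Empty, Empty.elim, fun i => i.elim, fun x hx => ⟨0, ?_⟩, fun c _ i => i.elim⟩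
    have : x = 0 := by simpa [pow_succ] using hx
    simp [this]

theorem nzd_pow {J : Ideal A} (hJ : ∀ n, QuasiReg J n) {a : A}
    (ha : ∀ x, a * x ∈ J → x ∈ J) (n : ℕ) : ∀ x, a * x ∈ J ^ n → x ∈ J ^ n := by
  induction n with
  | zero => simp
  | succ n ih =>
    intro x hx
    have h1 := ih x (Ideal.pow_le_pow_right (Nat.le_succ n) hx)
    obtain ⟨ι, e, he, hs, hi⟩ := hJ n
    obtain ⟨c, hc⟩ := hs x h1
    have h2 : Finsupp.linearCombination A e (a • c) ∈ J ^ (n + 1) := by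
      have := (J ^ (n + 1)).sub_mem hx ((J ^ (n + 1)).mul_mem_left a hc)
      rw [map_smul, smul_eq_mul]
      convert this using 1
      ring
    have h3 : ∀ i, c i ∈ J := fun i => ha _ (hi _ h2 i)
    have h4 := lc_mem' he c h3
    rw [← pow_succ'] at h4
    simpa using (J ^ (n + 1)).add_mem hc h4

theorem sup_pow_le (J : Ideal A) (a : A) (n : ℕ) :
    (Ideal.span {a} ⊔ J) ^ (n + 1) ≤
      Ideal.span {a} * (Ideal.span {a} ⊔ J) ^ n ⊔ J ^ (n + 1) := by
  induction n with
  | zero => simp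
  | succ n ih =>
    set I := Ideal.span {a} ⊔ J with hI
    have hJI : J ≤ I := le_sup_right
    calc I ^ (n + 1 + 1) = Ideal.span {a} * I ^ (n + 1) ⊔ J * I ^ (n + 1) := by
          rw [pow_succ' I (n + 1), ← Ideal.sup_mul]
      _ ≤ _ := by
        refine sup_le le_sup_left ?_
        refine (Ideal.mul_mono_right ih).trans ?_
        rw [Ideal.mul_sup, ← pow_succ']
        refine sup_le_sup ?_ le_rfl
        rw [mul_left_comm, pow_succ' I n]
        exact Ideal.mul_mono_right (Ideal.mul_mono_left hJI)

theorem quasiReg_step {J : Ideal A} (hJ : ∀ n, QuasiReg J n) {a : A}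
    (ha : ∀ x, a * x ∈ J → x ∈ J) (n : ℕ) : QuasiReg (Ideal.span {a} ⊔ J) n := by
  induction n with
  | zero => exact quasiReg_zero _
  | succ n ih =>
    set I := Ideal.span {a} ⊔ J with hI
    have hJI : J ≤ I := le_sup_right
    have haI : a ∈ I := Ideal.mem_sup_left (Ideal.mem_span_singleton_self a)
    have hJIn : ∀ n, J ^ n ≤ I ^ n := fun n => Ideal.pow_right_mono hJI n
    have dec : ∀ n, ∀ x ∈ I ^ (n + 1), ∃ z ∈ I ^ n, ∃ y ∈ J ^ (n + 1), a * z + y = x := by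
      intro n x hx
      obtain ⟨u, hu, y, hy, rfl⟩ := Submodule.mem_sup.1 (sup_pow_le J a n hx)
      obtain ⟨z, hz, rfl⟩ := Ideal.mem_span_singleton_mul.1 hu
      exact ⟨z, hz, y, hy, rfl⟩
    have haI' : ∀ n, ∀ x ∈ I ^ n, a * x ∈ I ^ (n + 1) := fun n x hx => by
      rw [pow_succ']; exact Ideal.mul_mem_mul haI hx
    obtain ⟨ι, e, he, hs, hi⟩ := ih
    obtain ⟨κ, f, hf, ht, hj⟩ := hJ (n + 1)
    have key : ∀ c : (ι ⊕ κ) →₀ A, Finsupp.linearCombination A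
        (Sum.elim (fun i => a * e i) f) c =
        a * Finsupp.linearCombination A e (Finsupp.sumFinsuppEquivProdFinsupp c).1 +
          Finsupp.linearCombination A f (Finsupp.sumFinsuppEquivProdFinsupp c).2 := by
      intro c
      induction c using Finsupp.induction_linear with
      | zero => simp
      | add p q hp hq =>
        have : Finsupp.sumFinsuppEquivProdFinsupp (p + q) =
          Finsupp.sumFinsuppEquivProdFinsupp p + Finsupp.sumFinsuppEquivProdFinsupp q :=
          Finsupp.sumFinsuppAddEquivProdFinsupp.map_add p q
        rw [map_add, hp, hq, this]
        simp only [Prod.fst_add, Prod.snd_add, map_add]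
        ring
      | single i r =>
        rcases i with i | i
        · have h1 : (Finsupp.sumFinsuppEquivProdFinsupp
            (Finsupp.single (Sum.inl i : ι ⊕ κ) r)) = (Finsupp.single i r, 0) := by
            apply Finsupp.sumFinsuppEquivProdFinsupp.symm.injective
            ext (j | j) <;> simp
          rw [h1]; simp; ring
        · have h1 : (Finsupp.sumFinsuppEquivProdFinsupp
            (Finsupp.single (Sum.inr i : ι ⊕ κ) r)) = (0, Finsupp.single i r) := by
            apply Finsupp.sumFinsuppEquivProdFinsupp.symm.injective
            ext (j | j) <;> simp
          rw [h1]; simp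
    refine ⟨ι ⊕ κ, Sum.elim (fun i => a * e i) f, ?_, ?_, ?_⟩
    · rintro (i | i)
      · exact haI' _ _ (he i)
      · exact hJIn _ (hf i)
    · intro x hx
      obtain ⟨z, hz, y, hy, rfl⟩ := dec n x hx
      obtain ⟨c, hc⟩ := hs z hz
      obtain ⟨d, hd⟩ := ht y hy
      refine ⟨Finsupp.sumFinsuppEquivProdFinsupp.symm (c, d), ?_⟩
      rw [key, Equiv.apply_symm_apply]
      have := (I ^ (n + 1 + 1)).add_mem (haI' _ _ hc) (hJIn _ hd)
      convert this using 1
      ring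
    · intro c hc
      rw [key] at hc
      obtain ⟨z, hz, w, hw, hzw⟩ := dec _ _ hc
      set p := (Finsupp.sumFinsuppEquivProdFinsupp c).1 with hp
      set q := (Finsupp.sumFinsuppEquivProdFinsupp c).2 with hq
      have hy : Finsupp.linearCombination A e p - z ∈ J ^ (n + 1) := by
        apply nzd_pow hJ ha
        have := (J ^ (n + 1)).sub_mem (Ideal.pow_le_pow_right (Nat.le_succ _) hw) (lc_mem hf q)
        convert this using 1
        linear_combination -hzw
      have hp' : ∀ i, p i ∈ I := by
        apply hi
        have := (I ^ (n + 1)).add_mem (hJIn _ hy) hz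
        simpa using this
      obtain ⟨g, hg⟩ := ht _ hy
      have hq' : ∀ i, q i ∈ I := by
        have h1 : Finsupp.linearCombination A f (q + a • g) ∈ J ^ (n + 1 + 1) := by
          have := (J ^ (n + 1 + 1)).sub_mem hw ((J ^ (n + 1 + 1)).mul_mem_left a hg)
          convert this using 1
          rw [map_add, map_smul, smul_eq_mul]
          linear_combination -hzw
        intro i
        have h2 := hJI (hj _ h1 i)
        have h3 := I.sub_mem h2 (I.mul_mem_right (g i) haI)
        simpa using h3
      rintro (i | i)
      · exact hp' i
      · exact hq' i

theorem quasiReg_of_isRegularSeq {rs : List A} (h : IsRegularSeq rs) (n : ℕ) :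
    QuasiReg (Ideal.span {a | a ∈ rs}) n := by
  have : ∀ k ≤ rs.length, ∀ n, QuasiReg (Ideal.span {a | a ∈ rs.take k}) n := by
    intro k
    induction k with
    | zero => intro _ n; simpa using quasiReg_bot n
    | succ k ih =>
      intro hk n
      have := quasiReg_step (ih (by omega)) (h.1 ⟨k, hk⟩) n
      convert this using 1
      rw [← Ideal.span_union]
      congr 1
      ext x
      have hx : x ∈ List.take (k + 1) rs ↔ x ∈ List.take k rs ∨ x = rs[k] := by
        rw [← List.take_append_getElem hk, List.mem_append, List.mem_singleton]
      simpa [or_comm] using hx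
  simpa using this rs.length le_rfl n

end quasi

section flat
variable {B A : Type} [CommRing B] [CommRing A] [Algebra B A]

theorem flat_quot {I : Ideal A} (hflat : Module.Flat B (A ⧸ I)) {n : ℕ} (h : QuasiReg I n) :
    ∃ (P : Type) (_ : AddCommGroup P) (_ : Module B P) (_ : Module.Flat B P)
      (f : ↥(I ^ n) →ₗ[B] P), Function.Surjective f ∧
        ∀ x, f x = 0 ↔ (x : A) ∈ I ^ (n + 1) := by
  obtain ⟨ι, e, he, hs, hi⟩ := h
  let e' : ι → ↥(I ^ n) := fun i => ⟨e i, he i⟩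
  let N := Submodule.comap (I ^ n).subtype (I ^ (n + 1))
  let φ : (ι →₀ A) →ₗ[A] (↥(I ^ n) ⧸ N) := N.mkQ ∘ₗ Finsupp.linearCombination A e'
  have hval : ∀ c, ((Finsupp.linearCombination A e' c : ↥(I ^ n)) : A) =
      Finsupp.linearCombination A e c := by
    intro c
    have := LinearMap.congr_fun (Finsupp.linearCombination_linear_comp A (I ^ n).subtype (v := e')) c
    simpa [e', Function.comp_def] using this.symm
  have hφ : Function.Surjective φ := by
    intro y
    obtain ⟨x, rfl⟩ := N.mkQ_surjective y
    obtain ⟨c, hc⟩ := hs x x.2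
    refine ⟨c, ?_⟩
    symm
    rw [← sub_eq_zero]
    change N.mkQ x - N.mkQ _ = 0
    rw [← map_sub, Submodule.mkQ_apply, Submodule.Quotient.mk_eq_zero]
    change ((x - Finsupp.linearCombination A e' c : ↥(I ^ n)) : A) ∈ I ^ (n + 1)
    rw [Submodule.coe_sub, hval]
    exact hc
  let ψ : (ι →₀ A) →ₗ[A] (ι →₀ A ⧸ I) := Finsupp.mapRange.linearMap I.mkQ
  have hψ : Function.Surjective ψ :=
    Finsupp.mapRange_surjective _ (map_zero I.mkQ) I.mkQ_surjective
  have hker : LinearMap.ker ψ = LinearMap.ker φ := by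
    ext c
    have h1 : c ∈ LinearMap.ker φ ↔ Finsupp.linearCombination A e c ∈ I ^ (n + 1) := by
      rw [LinearMap.mem_ker]
      change N.mkQ _ = 0 ↔ _
      rw [Submodule.mkQ_apply, Submodule.Quotient.mk_eq_zero, ← hval]
      rfl
    have h2 : c ∈ LinearMap.ker ψ ↔ ∀ i, c i ∈ I := by
      rw [LinearMap.mem_ker, Finsupp.ext_iff]
      refine forall_congr' fun i => ?_
      simp [ψ, Ideal.Quotient.eq_zero_iff_mem]
    rw [h1, h2]
    refine ⟨fun h => ?_, hi c⟩
    rw [pow_succ']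
    exact lc_mem' he c h
  let E : (ι →₀ A ⧸ I) ≃ₗ[A] (↥(I ^ n) ⧸ N) :=
    (ψ.quotKerEquivOfSurjective hψ).symm ≪≫ₗ Submodule.quotEquivOfEq _ _ hker ≪≫ₗ
      φ.quotKerEquivOfSurjective hφ
  have hP : Module.Flat B (ι →₀ A ⧸ I) := by
    classical
    exact Module.Flat.of_linearEquiv (finsuppLEquivDirectSum B (A ⧸ I) ι)
  refine ⟨ι →₀ A ⧸ I, inferInstance, inferInstance, hP,
    (E.symm.toLinearMap ∘ₗ N.mkQ).restrictScalars B,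
    E.symm.surjective.comp N.mkQ_surjective, fun x => ?_⟩
  change E.symm (N.mkQ x) = 0 ↔ _
  rw [LinearEquiv.map_eq_zero_iff, Submodule.mkQ_apply, Submodule.Quotient.mk_eq_zero]
  rfl

/-- The `B`-linear inclusion of a power of `I`. -/
def powIncl (B : Type) [CommRing B] [Algebra B A] (I : Ideal A) (n : ℕ) : ↥(I ^ n) →ₗ[B] A :=
  (I ^ n).subtype.restrictScalars B

theorem powIncl_injective {I : Ideal A} (hflat : Module.Flat B (A ⧸ I))
    (h : ∀ n, QuasiReg I n) (C : Type) [CommRing C] [Algebra B C] (n : ℕ) :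
    Function.Injective ((powIncl B I n).rTensor C) := by
  rw [← LinearMap.lTensor_inj_iff_rTensor_inj]
  induction n with
  | zero =>
    have hb : Function.Bijective (powIncl B I 0) :=
      ⟨Subtype.val_injective, fun x => ⟨⟨x, by simp⟩, rfl⟩⟩
    exact ((LinearEquiv.ofBijective _ hb).lTensor C).injective
  | succ n ih =>
    let g : ↥(I ^ (n + 1)) →ₗ[B] ↥(I ^ n) :=
      (Submodule.inclusion (Ideal.pow_le_pow_right (Nat.le_succ n))).restrictScalars B
    obtain ⟨P, _, _, _, f, hf, hf0⟩ := flat_quot hflat (h n)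
    have hg : Function.Injective (g.lTensor C) := by
      refine LinearMap.lTensor_injective_of_exact_of_flat f hf g
        (Submodule.inclusion_injective (Ideal.pow_le_pow_right (Nat.le_succ n))) ?_ C
      intro x
      rw [hf0]
      constructor
      · intro hx
        exact ⟨⟨x, hx⟩, rfl⟩
      · rintro ⟨y, rfl⟩
        exact y.2
    have : powIncl B I (n + 1) = powIncl B I n ∘ₗ g := rfl
    rw [this, LinearMap.lTensor_comp]
    exact ih.comp hg

end flat

section rees
variable {B A : Type} [CommRing B] [CommRing A] [Algebra B A]

/-- The degree `n` component of the Rees algebra. -/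
noncomputable def reesCoeff (B : Type) [CommRing B] [Algebra B A] (I : Ideal A) (n : ℕ) :
    reesAlgebra I →ₗ[B] ↥(I ^ n) where
  toFun f := ⟨(f : Polynomial A).coeff n, f.2 n⟩
  map_add' f g := by ext; simp
  map_smul' b f := by ext; simp

/-- The inclusion of the degree `n` component of the Rees algebra. -/
noncomputable def reesMonomial (B : Type) [CommRing B] [Algebra B A] (I : Ideal A) (n : ℕ) :
    ↥(I ^ n) →ₗ[B] reesAlgebra I where
  toFun x := ⟨Polynomial.monomial n (x : A), reesAlgebra.monomial_mem.2 x.2⟩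
  map_add' f g := by ext; simp
  map_smul' b f := by
    apply Subtype.ext
    change Polynomial.monomial n (b • (f : A)) = b • Polynomial.monomial n (f : A)
    exact (Polynomial.smul_monomial ..).symm

variable (C : Type) [CommRing C] [Algebra B C]

theorem reesMap_coeff (I : Ideal A) (n : ℕ) (t : (reesAlgebra I) ⊗[B] C) :
    (reesBaseChangeMap B A C I t).coeff n =
      (powIncl B I n).rTensor C ((reesCoeff B I n).rTensor C t) := by
  induction t with
  | zero => simp
  | add x y hx hy => simp only [map_add, Polynomial.coeff_add, hx, hy]
  | tmul f c =>
    rw [reesBaseChangeMap, Algebra.TensorProduct.productMap_apply_tmul]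
    simp only [AlgHom.comp_apply, LinearMap.rTensor_tmul]
    change (Polynomial.map _ _ * Polynomial.C _).coeff n = _
    rw [Polynomial.coeff_mul_C, Polynomial.coeff_map]
    simp [powIncl, reesCoeff]

theorem rees_decomp (I : Ideal A) (t : (reesAlgebra I) ⊗[B] C) :
    ∃ N, ∀ M ≥ N, t = ∑ n ∈ Finset.range M,
      (reesMonomial B I n).rTensor C ((reesCoeff B I n).rTensor C t) := by
  induction t with
  | zero => exact ⟨0, by simp⟩
  | add x y hx hy =>
    obtain ⟨N, hN⟩ := hx
    obtain ⟨N', hN'⟩ := hy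
    refine ⟨max N N', fun M hM => ?_⟩
    simp only [map_add, Finset.sum_add_distrib]
    rw [← hN M (le_trans (le_max_left _ _) hM), ← hN' M (le_trans (le_max_right _ _) hM)]
  | tmul f c =>
    refine ⟨(f : Polynomial A).natDegree + 1, fun M hM => ?_⟩
    simp only [LinearMap.rTensor_tmul]
    rw [← TensorProduct.sum_tmul]
    congr 1
    apply Subtype.ext
    rw [AddSubmonoidClass.coe_finsetSum]
    exact Polynomial.as_sum_range' _ _ hM

theorem rees_injective (I : Ideal A)
    (h : ∀ n, Function.Injective ((powIncl B I n).rTensor C)) :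
    Function.Injective (reesBaseChangeMap B A C I) := by
  rw [injective_iff_map_eq_zero]
  intro t ht
  obtain ⟨N, hN⟩ := rees_decomp C I t
  rw [hN N le_rfl]
  refine Finset.sum_eq_zero fun n _ => ?_
  have : (reesCoeff B I n).rTensor C t = 0 := by
    apply h n
    rw [← reesMap_coeff, ht]
    simp
  rw [this, map_zero]

theorem rees_range (I : Ideal A) :
    (reesBaseChangeMap B A C I).range =
        Subalgebra.restrictScalars B
          (reesAlgebra (I.map (algebraMap A (A ⊗[B] C)))) := by
  apply le_antisymm
  · rintro _ ⟨t, rfl⟩ n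
    change (reesBaseChangeMap B A C I t).coeff n ∈ _
    rw [reesMap_coeff, ← Ideal.map_pow]
    generalize (reesCoeff B I n).rTensor C t = s
    induction s with
    | zero => simp
    | add x y hx hy => rw [map_add]; exact Ideal.add_mem _ hx hy
    | tmul x c =>
      have : (powIncl B I n).rTensor C (x ⊗ₜ c) =
          (1 ⊗ₜ c) * algebraMap A (A ⊗[B] C) (x : A) := by
        simp [powIncl]
      rw [this]
      exact Ideal.mul_mem_left _ _ (Ideal.mem_map_of_mem _ x.2)
  · intro p hp
    rw [p.as_sum_support]
    refine Subalgebra.sum_mem _ fun n _ => ?_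
    have hc : p.coeff n ∈ _ := hp n
    generalize p.coeff n = s at hc
    rw [← Ideal.map_pow] at hc
    refine Submodule.span_induction (p := fun s _ => Polynomial.monomial n s ∈
      (reesBaseChangeMap B A C I).range) ?_ ?_ ?_ ?_ (show s ∈ Submodule.span _ _ from hc)
    · rintro _ ⟨x, hx, rfl⟩
      refine ⟨⟨Polynomial.monomial n x, reesAlgebra.monomial_mem.2 hx⟩ ⊗ₜ 1, ?_⟩
      change reesBaseChangeMap B A C I _ = _
      rw [reesBaseChangeMap, Algebra.TensorProduct.productMap_apply_tmul]
      simp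
    · simp
    · intro x y _ _ hx hy
      rw [map_add]
      exact Subalgebra.add_mem _ hx hy
    · intro r x _ hx
      have hr : Polynomial.C r ∈ (reesBaseChangeMap B A C I).range := by
        induction r with
        | zero => simp
        | add x y hx hy => rw [map_add]; exact Subalgebra.add_mem _ hx hy
        | tmul u c =>
          refine ⟨(algebraMap A (reesAlgebra I) u) ⊗ₜ c, ?_⟩
          change reesBaseChangeMap B A C I _ = _
          rw [reesBaseChangeMap, Algebra.TensorProduct.productMap_apply_tmul]
          change Polynomial.map _ (Polynomial.C u) * Polynomial.C _ = _
          rw [Polynomial.map_C, ← Polynomial.C_mul]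
          simp
      have := Subalgebra.mul_mem _ hr hx
      rwa [Polynomial.C_mul_monomial] at this

end rees

/-- The formation of the Rees algebra of an ideal generated by a regular sequence with
flat quotient, over a smooth algebra over a Noetherian base, commutes with arbitrary base
change: the canonical map `R_I(A) ⊗_B C → R_J(A ⊗_B C)` (where `J = I·(A ⊗_B C)`) is an
isomorphism, i.e. the canonical map to `(A ⊗_B C)[X]` is injective with image exactly the
Rees algebra of `J`. -/
theorem reesAlgebra_baseChange
    (B : Type) [CommRing B] [IsNoetherianRing B]
    (A : Type) [CommRing A] [Algebra B A]
    [Algebra.FormallySmooth B A] (hfp : Algebra.FinitePresentation B A)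
    (I : Ideal A) (rs : List A)
    (hgen : Ideal.span {a | a ∈ rs} = I)
    (hreg : IsRegularSeq rs)
    (hflat : Module.Flat B (A ⧸ I))
    (C : Type) [CommRing C] [Algebra B C] :
    Function.Injective (reesBaseChangeMap B A C I) ∧
      (reesBaseChangeMap B A C I).range =
        Subalgebra.restrictScalars B
          (reesAlgebra (I.map (algebraMap A (A ⊗[B] C)))) := by
  have hq : ∀ n, QuasiReg I n := fun n => hgen ▸ quasiReg_of_isRegularSeq hreg n
  exact ⟨rees_injective C I fun n => powIncl_injective hflat hq C n, rees_range C I⟩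
end
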